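/- arXiv:1706.07417 — 4 statements merged into one kernel-verified Lean document; each statement's English description precedes it below -/
import Mathlib

section
/- Let h > 0, θ ∈ (1/8, 3/8), and n ∈ ℤ. Then there exists a constant C > 0 such that for every j ∈ ℤ with j ≠ n, |g_θ(j) − g_θ(n)| ≥ ⟨j − n⟩ / C. -/
/-- The Japanese bracket `⟨m⟩ = √(2(m² + 1))` of an integer `m`. -/
noncomputable def bracket (m : ℤ) : ℝ := Real.sqrt (2 * ((m : ℝ) ^ 2 + 1))

/-- The flat-bottom dispersion function `g_θ(k) = (k + θ)·tanh(h·(k + θ))`. -/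
noncomputable def dispersion (h θ : ℝ) (k : ℤ) : ℝ :=
  ((k : ℝ) + θ) * Real.tanh (h * ((k : ℝ) + θ))

theorem mul_tanh_mul_abs (h x : ℝ) :
    |x| * Real.tanh (h * |x|) = x * Real.tanh (h * x) := by
  rcases abs_choice x with hx | hx <;> rw [hx]
  rw [mul_neg, Real.tanh_neg, neg_mul_neg]

theorem Real.tanh_monotone : Monotone Real.tanh := by
  intro x y hxy
  rw [Real.tanh_eq_sinh_div_cosh, Real.tanh_eq_sinh_div_cosh,
    div_le_div_iff₀ (Real.cosh_pos x) (Real.cosh_pos y)]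
  have hs : 0 ≤ Real.sinh (y - x) := Real.sinh_nonneg_iff.2 (sub_nonneg.2 hxy)
  rw [Real.sinh_sub] at hs
  linarith

/-- On `[c, ∞)` with `c ≥ 0`, the function `x ↦ x * tanh (h * x)` expands distances by at
least the factor `tanh (h * c)`. -/
theorem abs_sub_mul_tanh_le {h c a b : ℝ} (hh : 0 ≤ h) (hc : 0 ≤ c) (ha : c ≤ a) (hb : c ≤ b) :
    |a - b| * Real.tanh (h * c) ≤ |a * Real.tanh (h * a) - b * Real.tanh (h * b)| := by
  wlog hab : b ≤ a generalizing a b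
  · rw [abs_sub_comm a, abs_sub_comm (a * _)]
    exact this hb ha (le_of_not_ge hab)
  have hca : Real.tanh (h * c) ≤ Real.tanh (h * a) :=
    Real.tanh_monotone (mul_le_mul_of_nonneg_left ha hh)
  have hba : Real.tanh (h * b) ≤ Real.tanh (h * a) :=
    Real.tanh_monotone (mul_le_mul_of_nonneg_left hab hh)
  rw [abs_of_nonneg (sub_nonneg.2 hab)]
  refine le_trans ?_ (le_abs_self _)
  nlinarith [mul_le_mul_of_nonneg_left hca (sub_nonneg.2 hab),
    mul_le_mul_of_nonneg_left hba (hc.trans hb)]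

theorem bracket_le_two_mul_abs {m : ℤ} (hm : m ≠ 0) : bracket m ≤ 2 * |(m : ℝ)| := by
  have h1 : (1 : ℝ) ≤ |(m : ℝ)| := by exact_mod_cast Int.one_le_abs hm
  refine Real.sqrt_le_iff.2 ⟨by positivity, ?_⟩
  nlinarith [sq_abs (m : ℝ)]

theorem eighth_le_abs_add {θ : ℝ} (hθ₁ : 1 / 8 < θ) (hθ₂ : θ < 3 / 8) (k : ℤ) :
    1 / 8 ≤ |(k : ℝ) + θ| := by
  rcases le_or_gt 0 k with hk | hk
  · have hk' : (0 : ℝ) ≤ k := by exact_mod_cast hk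
    exact le_abs.2 (Or.inl (by linarith))
  · have hk' : (k : ℝ) ≤ -1 := by exact_mod_cast Int.le_sub_one_of_lt hk
    exact le_abs.2 (Or.inr (by linarith))

theorem quarter_le_abs_sub_abs {θ : ℝ} (hθ₁ : 1 / 8 < θ) (hθ₂ : θ < 3 / 8) {j n : ℤ}
    (hjn : j ≠ n) : 1 / 4 ≤ |(|(j : ℝ) + θ| - |(n : ℝ) + θ|)| := by
  have hd : (j : ℝ) + 1 ≤ n ∨ (n : ℝ) + 1 ≤ j := by
    rcases lt_or_gt_of_ne hjn with h | h
    · exact Or.inl (by exact_mod_cast h)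
    · exact Or.inr (by exact_mod_cast h)
  have hs : (j : ℝ) + n ≤ -1 ∨ (0 : ℝ) ≤ j + n := by
    rcases le_or_gt 0 (j + n) with h | h
    · exact Or.inr (by exact_mod_cast h)
    · exact Or.inl (by exact_mod_cast Int.le_sub_one_of_lt h)
  rw [le_abs]
  rcases abs_cases ((j : ℝ) + θ) with ⟨h1, _⟩ | ⟨h1, _⟩ <;>
  rcases abs_cases ((n : ℝ) + θ) with ⟨h2, _⟩ | ⟨h2, _⟩ <;>
  rw [h1, h2] <;> rcases hd with hd | hd <;> rcases hs with hs | hs <;>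
  first
  | exact Or.inl (by linarith)
  | exact Or.inr (by linarith)

/-- For `h > 0`, `θ ∈ (1/8, 3/8)` and `n ∈ ℤ`, there is `C > 0` such that for every
`j ≠ n`, `|g_θ(j) − g_θ(n)| ≥ ⟨j − n⟩ / C`. -/
theorem dispersion_eigenvalue_separation_simple
    (h θ : ℝ) (hh : 0 < h) (hθ₁ : 1 / 8 < θ) (hθ₂ : θ < 3 / 8) (n : ℤ) :
    ∃ C : ℝ, 0 < C ∧ ∀ j : ℤ, j ≠ n →
      bracket (j - n) / C ≤ |dispersion h θ j - dispersion h θ n| := by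
  have ht : 0 < Real.tanh (h * (1 / 8)) := by
    rw [Real.tanh_eq_sinh_div_cosh]
    exact div_pos (Real.sinh_pos_iff.2 (by positivity)) (Real.cosh_pos _)
  refine ⟨2 * (1 + 8 * |(n : ℝ) + θ|) / Real.tanh (h * (1 / 8)), by positivity, fun j hj => ?_⟩
  have hbr := bracket_le_two_mul_abs (sub_ne_zero.2 hj)
  have hgap := quarter_le_abs_sub_abs hθ₁ hθ₂ hj
  have hmain := abs_sub_mul_tanh_le hh.le (by norm_num) (eighth_le_abs_add hθ₁ hθ₂ j)
    (eighth_le_abs_add hθ₁ hθ₂ n)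
  rw [mul_tanh_mul_abs, mul_tanh_mul_abs] at hmain
  have htri : |((j - n : ℤ) : ℝ)| ≤ |(j : ℝ) + θ| + |(n : ℝ) + θ| := by
    have := abs_sub ((j : ℝ) + θ) ((n : ℝ) + θ)
    rwa [add_sub_add_right_eq_sub, ← Int.cast_sub] at this
  refine le_trans ?_ hmain
  rw [div_le_iff₀ (by positivity), mul_assoc, mul_div_cancel₀ _ ht.ne']
  nlinarith [le_abs_self (|(j : ℝ) + θ| - |(n : ℝ) + θ|),
    mul_le_mul_of_nonneg_left hgap (abs_nonneg ((n : ℝ) + θ))]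
end

section
/- Let h > 0, θ ∈ ℝ, n ∈ ℤ, r ≥ 1, and suppose α > 0 is such that |g_θ(j) − g_θ(n)| ≥ α·⟨j − n⟩ for all j ∈ ℤ with j ≠ n. Let N : ℤ × ℤ → ℂ be Hermitian (N_{jk} = conj(N_{kj})), with N_{jk} = 0 unless j = n or k = n, N_{nn} = 0, and with K := max( sup_{j≠n} |N_{jn}|·⟨j−n⟩^{r−1}, Σ_{k≠n} |N_{nk}|·⟨n−k⟩^{r−1} ) < ∞. Define V : ℤ × ℤ → ℂ by V_{jn} = N_{jn}/(g_θ(j) − g_θ(n)) for j ≠ n, V_{nk} = N_{nk}/(g_θ(n) − g_θ(k)) for k ≠ n, and V_{jk} = 0 otherwise. Then: (i) V is anti-Hermitian, i.e. V_{jk} = −conj(V_{kj}) for all j, k; (ii) (g_θ(j) − g_θ(k))·V_{jk} = N_{jk} whenever exactly one of j, k equals n (so V solves the commutator equation [G_θ, V] = N on the off-diagonal block); and (iii) sup_{j∈ℤ} Σ_{k∈ℤ} |V_{jk}|·⟨j−k⟩^r ≤ K/α. -/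
open scoped ENNReal

/-- The solution `V` of the commutator equation `[G_θ, V] = N` on the off-diagonal
block: `V_{jn} = N_{jn}/(g_θ(j) − g_θ(n))` for `j ≠ n`,
`V_{nk} = N_{nk}/(g_θ(n) − g_θ(k))` for `k ≠ n`, and `V_{jk} = 0` otherwise. -/
noncomputable def commutatorSolution (h θ : ℝ) (n : ℤ) (N : ℤ → ℤ → ℂ) (j k : ℤ) : ℂ :=
  if j = n then
    (if k = n then 0 else N n k / ((dispersion h θ n - dispersion h θ k : ℝ) : ℂ))
  else
    (if k = n then N j n / ((dispersion h θ j - dispersion h θ n : ℝ) : ℂ) else 0)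

theorem bracket_pos (m : ℤ) : 0 < bracket m := Real.sqrt_pos.2 (by positivity)

theorem bracket_sub_comm (j k : ℤ) : bracket (j - k) = bracket (k - j) := by
  unfold bracket
  congr 3
  push_cast
  ring

theorem div_mul_rpow_le {a b d α : ℝ} (r : ℝ) (ha : 0 ≤ a) (hb : 0 < b) (hα : 0 < α)
    (hd : α * b ≤ d) : a / d * b ^ r ≤ α⁻¹ * (a * b ^ (r - 1)) := by
  calc a / d * b ^ r ≤ a / (α * b) * b ^ r := by gcongr
    _ = α⁻¹ * (a * b ^ (r - 1)) := by
      rw [Real.rpow_sub_one hb.ne']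
      field_simp

theorem nnnorm_div_mul_rpow_le {z : ℂ} {b d α : ℝ} (r : ℝ) (hb : 0 < b) (hα : 0 < α)
    (hd : α * b ≤ |d|) :
    (‖z / (d : ℂ)‖₊ : ℝ≥0∞) * ENNReal.ofReal (b ^ r) ≤
      ENNReal.ofReal α⁻¹ * ENNReal.ofReal (‖z‖ * b ^ (r - 1)) := by
  rw [← ENNReal.ofReal_mul (inv_nonneg.2 hα.le), ← enorm_eq_nnnorm, ← ofReal_norm,
    ← ENNReal.ofReal_mul (norm_nonneg _), norm_div, Complex.norm_real, Real.norm_eq_abs]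
  exact ENNReal.ofReal_le_ofReal (div_mul_rpow_le r (norm_nonneg z) hb hα hd)

/-- Invertibility of the linearized conjugation map `∂_T F(0,0)`: given the eigenvalue
separation `|g_θ(j) − g_θ(n)| ≥ α⟨j−n⟩` and a Hermitian matrix `N` supported on the
`n`-th row and column with `N_{nn} = 0` and size `K`, the matrix `V` defined above is
anti-Hermitian, solves `(g_θ(j) − g_θ(k))·V_{jk} = N_{jk}` on the off-diagonal block,
and satisfies `sup_j Σ_k |V_{jk}|⟨j−k⟩^r ≤ K/α`. -/
theorem commutatorSolution_spec
    (h θ : ℝ) (hh : 0 < h) (n : ℤ) (r : ℝ) (hr : 1 ≤ r) (α : ℝ) (hα : 0 < α)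
    (hsep : ∀ j : ℤ, j ≠ n → α * bracket (j - n) ≤ |dispersion h θ j - dispersion h θ n|)
    (N : ℤ → ℤ → ℂ)
    (hHerm : ∀ j k : ℤ, N j k = starRingEnd ℂ (N k j))
    (hsupp : ∀ j k : ℤ, j ≠ n → k ≠ n → N j k = 0)
    (hnn : N n n = 0)
    (K : ℝ)
    (hK₁ : ∀ j : ℤ, j ≠ n → ‖N j n‖ * bracket (j - n) ^ (r - 1) ≤ K)
    (hK₂ : (∑' k : {k : ℤ // k ≠ n}, (‖N n (k : ℤ)‖₊ : ℝ≥0∞) *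
        ENNReal.ofReal (bracket (n - (k : ℤ)) ^ (r - 1))) ≤ ENNReal.ofReal K) :
    (∀ j k : ℤ, commutatorSolution h θ n N j k
        = -starRingEnd ℂ (commutatorSolution h θ n N k j)) ∧
    (∀ j k : ℤ, (j = n ∧ k ≠ n) ∨ (j ≠ n ∧ k = n) →
      ((dispersion h θ j - dispersion h θ k : ℝ) : ℂ) * commutatorSolution h θ n N j k
        = N j k) ∧
    (⨆ j : ℤ, ∑' k : ℤ, (‖commutatorSolution h θ n N j k‖₊ : ℝ≥0∞) *
        ENNReal.ofReal (bracket (j - k) ^ r)) ≤ ENNReal.ofReal (K / α) := by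
  have hne : ∀ j : ℤ, j ≠ n → dispersion h θ j - dispersion h θ n ≠ 0 := fun j hj =>
    abs_pos.1 ((mul_pos hα (bracket_pos _)).trans_le (hsep j hj))
  have hne' : ∀ k : ℤ, k ≠ n → dispersion h θ n - dispersion h θ k ≠ 0 := fun k hk => by
    rw [← neg_sub]
    exact neg_ne_zero.2 (hne k hk)
  refine ⟨fun j k => ?_, fun j k hjk => ?_, iSup_le fun j => ?_⟩
  · by_cases hj : j = n <;> by_cases hk : k = n <;>
      simp only [commutatorSolution, hj, hk, if_true, if_false, map_zero, neg_zero, map_div₀,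
        Complex.conj_ofReal, ← hHerm]
    all_goals
      rw [← div_neg, ← Complex.ofReal_neg, neg_sub]
  · rcases hjk with ⟨rfl, hk⟩ | ⟨hj, rfl⟩
    · simp only [commutatorSolution, hk, if_true, if_false]
      exact mul_div_cancel₀ _ (Complex.ofReal_ne_zero.2 (hne' k hk))
    · simp only [commutatorSolution, hj, if_true, if_false]
      exact mul_div_cancel₀ _ (Complex.ofReal_ne_zero.2 (hne j hj))
  · rw [div_eq_inv_mul, ENNReal.ofReal_mul (inv_nonneg.2 hα.le)]
    by_cases hj : j = n
    · subst hj
      rw [← tsum_subtype_eq_of_support_subset (s := {k : ℤ | k ≠ j})]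
      · refine le_trans ?_ (mul_le_mul_right hK₂ _)
        rw [← ENNReal.tsum_mul_left]
        refine ENNReal.tsum_le_tsum fun k => ?_
        have hk : (k : ℤ) ≠ j := k.2
        simp only [commutatorSolution, hk, if_true, if_false]
        rw [← enorm_eq_nnnorm (N j k), ← ofReal_norm,
          ← ENNReal.ofReal_mul (norm_nonneg _)]
        refine nnnorm_div_mul_rpow_le r (bracket_pos _) hα ?_
        rw [abs_sub_comm, bracket_sub_comm]
        exact hsep k hk
      · intro k hk hkj
        exact hk (by simp [commutatorSolution, hkj])
    · rw [tsum_eq_single n fun k hk => by simp [commutatorSolution, hj, hk]]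
      simp only [commutatorSolution, hj, if_true, if_false]
      refine (nnnorm_div_mul_rpow_le r (bracket_pos _) hα (hsep j hj)).trans ?_
      gcongr
      exact hK₁ j hj
end

section
/- Let 𝒜 be a complete normed ring (a Banach algebra), and let T, V ∈ 𝒜. Then the series D(T)V := Σ_{m=1}^∞ (1/m!) Σ_{p=0}^{m−1} T^p · V · T^{m−1−p} (the Fréchet derivative of the exponential map at T applied to V) converges absolutely in 𝒜, and for any T₁, T₂, V ∈ 𝒜, with a := max(‖T₁‖, ‖T₂‖), one has ‖D(T₁)V − D(T₂)V‖ ≤ e^a · ‖T₁ − T₂‖ · ‖V‖. -/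
/-- The directional derivative of the exponential map at `T` in the direction `V`:
`D(T)V = Σ_{m≥1} (1/m!) Σ_{p=0}^{m−1} T^p V T^{m−1−p}`. -/
noncomputable def expDeriv {𝒜 : Type*} [NormedRing 𝒜] [NormedAlgebra ℝ 𝒜] (T V : 𝒜) : 𝒜 :=
  ∑' m : ℕ, (((m.factorial : ℝ))⁻¹) • ∑ p ∈ Finset.range m, T ^ p * V * T ^ (m - 1 - p)

theorem norm_pow_mul_mul_pow_le {𝒜 : Type*} [NormedRing 𝒜] {T : 𝒜} {a : ℝ} (hT : ‖T‖ ≤ a)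
    (V : 𝒜) (p q : ℕ) : ‖T ^ p * V * T ^ q‖ ≤ a ^ (p + q) * ‖V‖ := by
  have ha : 0 ≤ a := (norm_nonneg T).trans hT
  induction p with
  | zero =>
    induction q with
    | zero => simp
    | succ q ih =>
      calc ‖T ^ 0 * V * T ^ (q + 1)‖ = ‖T ^ 0 * V * T ^ q * T‖ := by rw [pow_succ, mul_assoc _ _ T]
        _ ≤ (a ^ (0 + q) * ‖V‖) * a :=
          (norm_mul_le _ _).trans (mul_le_mul ih hT (norm_nonneg _) (by positivity))
        _ = a ^ (0 + (q + 1)) * ‖V‖ := by ring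
  | succ p ih =>
    calc ‖T ^ (p + 1) * V * T ^ q‖ = ‖T * (T ^ p * V * T ^ q)‖ := by
          simp only [pow_succ', mul_assoc]
      _ ≤ a * (a ^ (p + q) * ‖V‖) :=
        (norm_mul_le _ _).trans (mul_le_mul hT ih (norm_nonneg _) ha)
      _ = a ^ (p + 1 + q) * ‖V‖ := by ring

theorem norm_pow_mul_mul_pow_sub_le {𝒜 : Type*} [NormedRing 𝒜] {T₁ T₂ : 𝒜} {a : ℝ}
    (h₁ : ‖T₁‖ ≤ a) (h₂ : ‖T₂‖ ≤ a) (V : 𝒜) (p q : ℕ) :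
    ‖T₁ ^ p * V * T₁ ^ q - T₂ ^ p * V * T₂ ^ q‖ ≤
      (p + q : ℕ) * a ^ (p + q - 1) * ‖T₁ - T₂‖ * ‖V‖ := by
  have ha : 0 ≤ a := (norm_nonneg T₁).trans h₁
  have hpow (n : ℕ) : (n : ℝ) * a ^ (n - 1) * a = n * a ^ n := by
    cases n with
    | zero => simp
    | succ n => rw [Nat.add_sub_cancel, pow_succ, mul_assoc]
  induction p with
  | zero =>
    induction q with
    | zero => simp
    | succ q ih =>
      set X₁ := T₁ ^ 0 * V * T₁ ^ q with hX₁
      set X₂ := T₂ ^ 0 * V * T₂ ^ q with hX₂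
      have hX : ‖X₂‖ ≤ a ^ (0 + q) * ‖V‖ := norm_pow_mul_mul_pow_le h₂ V 0 q
      have e : T₁ ^ 0 * V * T₁ ^ (q + 1) - T₂ ^ 0 * V * T₂ ^ (q + 1) =
          (X₁ - X₂) * T₁ + X₂ * (T₁ - T₂) := by
        simp only [hX₁, hX₂, pow_succ]
        noncomm_ring
      rw [e]
      calc _ ≤ ‖X₁ - X₂‖ * ‖T₁‖ + ‖X₂‖ * ‖T₁ - T₂‖ :=
            norm_add_le_of_le (norm_mul_le _ _) (norm_mul_le _ _)
        _ ≤ ((0 + q : ℕ) * a ^ (0 + q - 1) * ‖T₁ - T₂‖ * ‖V‖) * a +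
            a ^ (0 + q) * ‖V‖ * ‖T₁ - T₂‖ := by gcongr
        _ = ((0 + q : ℕ) * a ^ (0 + q - 1) * a) * ‖T₁ - T₂‖ * ‖V‖ +
            a ^ (0 + q) * ‖V‖ * ‖T₁ - T₂‖ := by ring
        _ = _ := by
          rw [hpow, ← add_assoc, Nat.add_sub_cancel]
          push_cast
          ring
  | succ p ih =>
    set X₁ := T₁ ^ p * V * T₁ ^ q with hX₁
    set X₂ := T₂ ^ p * V * T₂ ^ q with hX₂
    have hX : ‖X₂‖ ≤ a ^ (p + q) * ‖V‖ := norm_pow_mul_mul_pow_le h₂ V p q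
    have e : T₁ ^ (p + 1) * V * T₁ ^ q - T₂ ^ (p + 1) * V * T₂ ^ q =
        T₁ * (X₁ - X₂) + (T₁ - T₂) * X₂ := by
      simp only [hX₁, hX₂, pow_succ', mul_sub, sub_mul, mul_assoc]
      abel
    rw [e]
    calc _ ≤ ‖T₁‖ * ‖X₁ - X₂‖ + ‖T₁ - T₂‖ * ‖X₂‖ :=
          norm_add_le_of_le (norm_mul_le _ _) (norm_mul_le _ _)
      _ ≤ a * ((p + q : ℕ) * a ^ (p + q - 1) * ‖T₁ - T₂‖ * ‖V‖) +
          ‖T₁ - T₂‖ * (a ^ (p + q) * ‖V‖) := by gcongr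
      _ = ((p + q : ℕ) * a ^ (p + q - 1) * a) * ‖T₁ - T₂‖ * ‖V‖ +
          ‖T₁ - T₂‖ * (a ^ (p + q) * ‖V‖) := by ring
      _ = _ := by
        rw [hpow, add_right_comm p 1 q, Nat.add_sub_cancel]
        push_cast
        ring

theorem summable_norm_expDeriv_term {𝒜 : Type*} [NormedRing 𝒜] [NormedAlgebra ℝ 𝒜] (T V : 𝒜) :
    Summable (fun m : ℕ =>
      ‖(((m.factorial : ℝ))⁻¹) • ∑ p ∈ Finset.range m, T ^ p * V * T ^ (m - 1 - p)‖) := by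
  rw [← summable_nat_add_iff 1]
  refine Summable.of_nonneg_of_le (fun _ => norm_nonneg _) (fun m => ?_)
    ((Real.summable_pow_div_factorial ‖T‖).mul_right ‖V‖)
  have hsum : ‖∑ p ∈ Finset.range (m + 1), T ^ p * V * T ^ (m + 1 - 1 - p)‖ ≤
      (m + 1 : ℕ) * (‖T‖ ^ m * ‖V‖) := by
    refine (norm_sum_le_of_le _ (f := fun p => T ^ p * V * T ^ (m + 1 - 1 - p))
      (n := fun _ => ‖T‖ ^ m * ‖V‖) fun p hp => ?_).trans (by simp)
    have hpm : p + (m + 1 - 1 - p) = m := by grind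
    simpa only [hpm] using norm_pow_mul_mul_pow_le le_rfl V p (m + 1 - 1 - p)
  rw [norm_smul, norm_inv, Real.norm_natCast]
  calc _ ≤ (((m + 1).factorial : ℝ))⁻¹ * ((m + 1 : ℕ) * (‖T‖ ^ m * ‖V‖)) := by gcongr
    _ = _ := by
      rw [Nat.factorial_succ]
      push_cast
      field_simp

theorem norm_expDeriv_term_sub_le {𝒜 : Type*} [NormedRing 𝒜] [NormedAlgebra ℝ 𝒜] {T₁ T₂ : 𝒜}
    {a : ℝ} (h₁ : ‖T₁‖ ≤ a) (h₂ : ‖T₂‖ ≤ a) (V : 𝒜) (m : ℕ) :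
    ‖((((m + 2).factorial : ℝ))⁻¹) •
          ∑ p ∈ Finset.range (m + 2), T₁ ^ p * V * T₁ ^ (m + 2 - 1 - p) -
        ((((m + 2).factorial : ℝ))⁻¹) •
          ∑ p ∈ Finset.range (m + 2), T₂ ^ p * V * T₂ ^ (m + 2 - 1 - p)‖ ≤
      a ^ m / m.factorial * (‖T₁ - T₂‖ * ‖V‖) := by
  rw [← smul_sub, ← Finset.sum_sub_distrib, norm_smul, norm_inv, Real.norm_natCast]
  have hsum : ‖∑ p ∈ Finset.range (m + 2),
      (T₁ ^ p * V * T₁ ^ (m + 2 - 1 - p) - T₂ ^ p * V * T₂ ^ (m + 2 - 1 - p))‖ ≤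
      (m + 2 : ℕ) * ((m + 1 : ℕ) * a ^ m * ‖T₁ - T₂‖ * ‖V‖) := by
    refine (norm_sum_le_of_le _ (n := fun _ => (m + 1 : ℕ) * a ^ m * ‖T₁ - T₂‖ * ‖V‖)
      fun p hp => ?_).trans (by simp)
    have hpm : p + (m + 2 - 1 - p) = m + 1 := by grind
    simpa only [hpm, Nat.add_sub_cancel] using
      norm_pow_mul_mul_pow_sub_le h₁ h₂ V p (m + 2 - 1 - p)
  calc _ ≤ (((m + 2).factorial : ℝ))⁻¹ *
        ((m + 2 : ℕ) * ((m + 1 : ℕ) * a ^ m * ‖T₁ - T₂‖ * ‖V‖)) := by gcongr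
    _ = _ := by
      rw [Nat.factorial_succ, Nat.factorial_succ]
      push_cast
      field_simp
      ring

/-- In a Banach algebra, the series defining the Fréchet derivative of the exponential
map converges absolutely, and it is Lipschitz in the base point:
`‖D(T₁)V − D(T₂)V‖ ≤ e^a·‖T₁ − T₂‖·‖V‖` with `a = max(‖T₁‖, ‖T₂‖)`. -/
theorem expDeriv_summable_and_lipschitz
    {𝒜 : Type*} [NormedRing 𝒜] [NormedAlgebra ℝ 𝒜] [CompleteSpace 𝒜] :
    (∀ T V : 𝒜, Summable (fun m : ℕ =>
        ‖(((m.factorial : ℝ))⁻¹) • ∑ p ∈ Finset.range m, T ^ p * V * T ^ (m - 1 - p)‖)) ∧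
    (∀ T₁ T₂ V : 𝒜,
      ‖expDeriv T₁ V - expDeriv T₂ V‖ ≤
        Real.exp (max ‖T₁‖ ‖T₂‖) * ‖T₁ - T₂‖ * ‖V‖) := by
  refine ⟨summable_norm_expDeriv_term, fun T₁ T₂ V => ?_⟩
  have s₁ := (summable_norm_expDeriv_term T₁ V).of_norm
  have s₂ := (summable_norm_expDeriv_term T₂ V).of_norm
  have hexp : HasSum (fun m : ℕ => max ‖T₁‖ ‖T₂‖ ^ m / m.factorial)
      (Real.exp (max ‖T₁‖ ‖T₂‖)) := by
    rw [Real.exp_eq_exp_ℝ]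
    exact NormedSpace.expSeries_div_hasSum_exp _
  rw [expDeriv, expDeriv, ← s₁.tsum_sub s₂, ← (s₁.sub s₂).sum_add_tsum_nat_add 2, mul_assoc]
  simp only [Finset.sum_range_succ _ 1, Finset.sum_range_one, Finset.sum_range_zero]
  simp only [pow_zero, Nat.sub_self, sub_self, zero_add]
  exact tsum_of_norm_bounded (hexp.mul_right _)
    (norm_expDeriv_term_sub_le (le_max_left _ _) (le_max_right _ _) V)
end

section
/- Let h > 0, r ≥ 1, let n ≥ 1 be an integer, and let θ ∈ (−3/8, 3/8). Then there exists ρ > 0 with the following property. For every Hermitian infinite matrix M : ℤ × ℤ → ℂ (M_{jl} = conj(M_{lj})) with ‖M‖_r := sup_j Σ_l |M_{jl}|·⟨j−l⟩^r < ρ, there exists an infinite matrix T : ℤ × ℤ → ℂ such that: (i) T is anti-Hermitian, T_{jk} = −conj(T_{kj}); (ii) T_{jk} = 0 unless exactly one of j, k belongs to {n, −n}; (iii) ‖T‖_r := sup_j Σ_l |T_{jl}|·⟨j−l⟩^r < ∞; and (iv) defining matrix powers by (T^{(1)}) = T and (T^{(m+1)})_{jk} = Σ_l (T^{(m)})_{jl}·T_{lk},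 the exponentials (Exp(±T))_{jk} := δ_{jk} + Σ_{m≥1} ((±T)^{(m)})_{jk}/m!, and the conjugated matrix C_{jk} := Σ_{l∈ℤ} (Exp(−T))_{jl}·g_θ(l)·(Exp(T))_{lk} + Σ_{l∈ℤ} Σ_{m∈ℤ} (Exp(−T))_{jl}·M_{lm}·(Exp(T))_{mk}, one has C_{jk} = 0 whenever exactly one of j, k belongs to {n, −n}. -/
open scoped ENNReal

/-- Iterated matrix powers: `matPow T m` is the `(m+1)`-st power `T^{(m+1)}` of the
infinite matrix `T`, defined by `T^{(1)} = T` and `(T^{(m+1)})_{jk} = Σ_l (T^{(m)})_{jl}T_{lk}`. -/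
noncomputable def matPow (T : ℤ → ℤ → ℂ) : ℕ → ℤ → ℤ → ℂ
  | 0 => T
  | m + 1 => fun j k => ∑' l : ℤ, matPow T m j l * T l k

/-- The matrix exponential `(Exp T)_{jk} = δ_{jk} + Σ_{m≥1} (T^{(m)})_{jk}/m!`. -/
noncomputable def matExp (T : ℤ → ℤ → ℂ) (j k : ℤ) : ℂ :=
  (if j = k then 1 else 0) + ∑' m : ℕ, matPow T m j k / ((m + 1).factorial : ℂ)

/-- The conjugated matrix `C = Exp(−T)(G_θ + M)Exp(T)`, with entries
`C_{jk} = Σ_l (Exp(−T))_{jl}·g_θ(l)·(Exp T)_{lk} + Σ_l Σ_m (Exp(−T))_{jl}·M_{lm}·(Exp T)_{mk}`. -/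
noncomputable def conjugated (h θ : ℝ) (M T : ℤ → ℤ → ℂ) (j k : ℤ) : ℂ :=
  (∑' l : ℤ, matExp (fun a b => -T a b) j l * ((dispersion h θ l : ℝ) : ℂ) * matExp T l k)
    + ∑' l : ℤ, ∑' m : ℤ, matExp (fun a b => -T a b) j l * M l m * matExp T m k

/-- A contraction argument for a quadratic (Riccati-type) system in a Banach space. -/
lemma exists_riccati_fixedPoint {E ι : Type*} [NormedAddCommGroup E] [NormedSpace ℂ E]
    [CompleteSpace E] [Fintype ι] {d W : ℝ} (hd : 0 ≤ d) (hW : 0 ≤ W)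
    (D : ι → E →L[ℂ] E) (hD : ∀ a, ‖D a‖ ≤ d) (e : ι → E) (he : ∀ a, ‖e a‖ ≤ W)
    (ev : ι → E →L[ℂ] ℂ) (hev : ∀ a, ‖ev a‖ ≤ 1) :
    ∃ ρ : ℝ, 0 < ρ ∧ ∀ A : E →L[ℂ] E, ‖A‖ ≤ ρ → ∃ X : ι → E, ∀ a,
      X a = D a (∑ b, ev b (A (e a + X a)) • X b - A (e a + X a)) := by
  set N : ℝ := ((Fintype.card ι : ℕ) : ℝ) with hN
  have hN0 : 0 ≤ N := by positivity
  refine ⟨1 / (2 * (d + 1) * (N + 1) * (W + 2)), by positivity, fun A hA => ?_⟩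
  set ρ : ℝ := 1 / (2 * (d + 1) * (N + 1) * (W + 2)) with hρ
  have hρ0 : 0 ≤ ρ := by positivity
  have hprod : d * (ρ * (N + 1) * (W + 2)) ≤ 1 / 2 := by
    have : d * (ρ * (N + 1) * (W + 2)) = (d / (d + 1)) * (1 / 2) := by
      rw [hρ]; field_simp
    rw [this]
    have : d / (d + 1) ≤ 1 := by rw [div_le_one (by positivity)]; linarith
    nlinarith
  let F : (ι → E) → ι → E := fun X a =>
    D a (∑ b, ev b (A (e a + X a)) • X b - A (e a + X a))
  have hAn : ∀ x, ‖A x‖ ≤ ρ * ‖x‖ := fun x => A.le_of_opNorm_le hA x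
  have hevA : ∀ b x, ‖ev b (A x)‖ ≤ ρ * ‖x‖ := fun b x =>
    ((ev b).le_of_opNorm_le (hev b) _).trans (by rw [one_mul]; exact hAn x)
  have hX : ∀ {X : ι → E}, X ∈ Metric.closedBall (0 : ι → E) 1 → ∀ a, ‖X a‖ ≤ 1 := by
    intro X hX a
    exact (norm_le_pi_norm X a).trans (mem_closedBall_zero_iff.1 hX)
  have hz : ∀ {X : ι → E}, X ∈ Metric.closedBall (0 : ι → E) 1 → ∀ a, ‖e a + X a‖ ≤ W + 1 :=
    fun h a => (norm_add_le _ _).trans (add_le_add (he a) (hX h a))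
  have hmaps : Set.MapsTo F (Metric.closedBall 0 1) (Metric.closedBall 0 1) := by
    intro X hXb
    rw [mem_closedBall_zero_iff, pi_norm_le_iff_of_nonneg zero_le_one]
    intro a
    calc ‖F X a‖ ≤ d * ‖∑ b, ev b (A (e a + X a)) • X b - A (e a + X a)‖ :=
          (D a).le_of_opNorm_le (hD a) _
      _ ≤ d * (∑ _b : ι, ρ * (W + 1) * 1 + ρ * (W + 1)) := by
          refine mul_le_mul_of_nonneg_left ((norm_sub_le _ _).trans (add_le_add ?_ ?_)) hd
          · refine norm_sum_le_of_le _ fun b _ => ?_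
            rw [norm_smul]
            gcongr
            · exact (hevA b _).trans (by gcongr; exact hz hXb a)
            · exact hX hXb b
          · exact (hAn _).trans (by gcongr; exact hz hXb a)
      _ = d * (ρ * (N + 1) * (W + 1)) := by
          simp only [Finset.sum_const, Finset.card_univ, nsmul_eq_mul, ← hN]; ring
      _ ≤ d * (ρ * (N + 1) * (W + 2)) := by gcongr; linarith
      _ ≤ 1 := by linarith
  have hlip : ∀ X ∈ Metric.closedBall (0 : ι → E) 1, ∀ Y ∈ Metric.closedBall (0 : ι → E) 1,
      dist (F X) (F Y) ≤ (1 / 2 : ℝ) * dist X Y := by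
    intro X hXb Y hYb
    rw [dist_eq_norm, dist_eq_norm, pi_norm_le_iff_of_nonneg (by positivity)]
    intro a
    have hΔ : ∀ b, ‖X b - Y b‖ ≤ ‖X - Y‖ := fun b => norm_le_pi_norm (X - Y) b
    have hsplit : (F X - F Y) a = D a (∑ b, (ev b (A (X a - Y a)) • X b
        + ev b (A (e a + Y a)) • (X b - Y b)) - A (X a - Y a)) := by
      simp only [F, Pi.sub_apply, ← map_sub]
      congr 1
      have h1 : X a - Y a = (e a + X a) - (e a + Y a) := by abel
      rw [sub_sub_sub_comm, ← Finset.sum_sub_distrib, h1, map_sub A]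
      congr 1
      refine Finset.sum_congr rfl fun b _ => ?_
      rw [map_sub, sub_smul, smul_sub]; abel
    rw [hsplit]
    calc _ ≤ d * ‖∑ b, (ev b (A (X a - Y a)) • X b
        + ev b (A (e a + Y a)) • (X b - Y b)) - A (X a - Y a)‖ := (D a).le_of_opNorm_le (hD a) _
      _ ≤ d * (∑ _b : ι, (ρ * ‖X - Y‖ * 1 + ρ * (W + 1) * ‖X - Y‖) + ρ * ‖X - Y‖) := by
          refine mul_le_mul_of_nonneg_left ((norm_sub_le _ _).trans (add_le_add ?_ ?_)) hd
          · refine norm_sum_le_of_le _ fun b _ => (norm_add_le _ _).trans (add_le_add ?_ ?_)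
            · rw [norm_smul]
              gcongr
              · exact (hevA b _).trans (by gcongr; exact hΔ a)
              · exact hX hXb b
            · rw [norm_smul]
              gcongr
              · exact (hevA b _).trans (by gcongr; exact hz hYb a)
              · exact hΔ b
          · exact (hAn _).trans (by gcongr; exact hΔ a)
      _ = d * (ρ * (N * (W + 2) + 1)) * ‖X - Y‖ := by
          simp only [Finset.sum_const, Finset.card_univ, nsmul_eq_mul, ← hN]; ring
      _ ≤ d * (ρ * (N + 1) * (W + 2)) * ‖X - Y‖ := by
          rw [mul_assoc ρ]
          gcongr
          nlinarith
      _ ≤ 1 / 2 * ‖X - Y‖ := by gcongr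
  have hcontr : ContractingWith (1 / 2) (hmaps.restrict F _ _) := by
    refine ⟨by norm_num, LipschitzWith.of_dist_le_mul fun X Y => ?_⟩
    change dist (F X) (F Y) ≤ ((1 / 2 : NNReal) : ℝ) * dist (X : ι → E) Y
    simpa using hlip X X.2 Y Y.2
  obtain ⟨X, -, hfix, -⟩ := hcontr.exists_fixedPoint' Metric.isClosed_closedBall.isComplete hmaps
    (Metric.mem_closedBall_self zero_le_one) (edist_ne_top _ _)
  exact ⟨X, fun a => (congrFun hfix a).symm⟩

open scoped lp

lemma memlp_one_of_summable {f : ℤ → ℂ} (hf : Summable fun l => ‖f l‖) :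
    Memℓp f 1 := memℓp_gen (by simpa using hf)

lemma lp_one_norm (f : ℓ^1(ℤ, ℂ)) : ‖f‖ = ∑' l, ‖f l‖ := by
  simp [lp.norm_eq_tsum_rpow (p := 1) (by simp)]

/-- A matrix with uniformly summable columns acts boundedly on `ℓ¹`. -/
lemma exists_clm_of_columns {N : ℤ → ℤ → ℂ} {C : ℝ} (hC : 0 ≤ C)
    (hs : ∀ l, Summable fun j => ‖N j l‖) (hN : ∀ l, ∑' j, ‖N j l‖ ≤ C) :
    ∃ A : ℓ^1(ℤ, ℂ) →L[ℂ] ℓ^1(ℤ, ℂ), ‖A‖ ≤ C ∧ ∀ y j, A y j = ∑' l, N j l * y l := by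
  let c : ℤ → ℓ^1(ℤ, ℂ) := fun l => ⟨fun j => N j l, memlp_one_of_summable (hs l)⟩
  have hc : ∀ l, ‖c l‖ ≤ C := fun l => by rw [lp_one_norm]; exact hN l
  have hc' : ∀ l, ‖ContinuousLinearMap.toSpanSingleton ℂ (c l)‖ ≤ C := fun l => by
    rw [ContinuousLinearMap.norm_toSpanSingleton]; exact hc l
  refine ⟨(lp.tsumCLM ℂ ℤ ℓ^1(ℤ, ℂ)).comp (lp.mapCLM 1
    (fun l => ContinuousLinearMap.toSpanSingleton ℂ (c l)) hC hc'), ?_, fun y j => ?_⟩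
  · refine (ContinuousLinearMap.opNorm_comp_le _ _).trans ?_
    have h1 := lp.norm_tsumCLM_le (α := ℤ) (𝕜 := ℂ) (E := ℓ^1(ℤ, ℂ))
    have h2 := lp.norm_mapCLM_le 1 _ hC hc'
    calc _ ≤ 1 * C := by gcongr
      _ = C := one_mul C
  · have hy : Summable fun l => y l • c l := by
      refine Summable.of_norm_bounded (g := fun l => ‖y l‖ * C) ?_ fun l => ?_
      · exact (by simpa using y.2.summable : Summable fun l => ‖y l‖).mul_right C
      · rw [norm_smul]; gcongr; exact hc l
    have := (lp.evalCLM ℂ (fun _ : ℤ => ℂ) 1 j).map_tsum hy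
    simp only [ContinuousLinearMap.comp_apply, lp.tsumCLM_apply]
    refine Eq.trans ?_ (this.trans ?_)
    · rfl
    · refine tsum_congr fun l => ?_
      show y l * N j l = _
      ring

/-- For a small matrix `M`, the diagonal matrix `g` plus `M` leaves invariant the span of the
vectors `e_a + X_a`, `a ∈ S`, where the `X_a` are supported off `S`. -/
lemma exists_invariant_graph (S : Finset ℤ) (g : ℤ → ℝ) {γ : ℝ} (hγ : 0 < γ)
    (hg : ∀ a ∈ S, ∀ l ∉ S, γ ≤ |g l - g a|) (w : ℤ → ℝ) (hw : ∀ l, 1 ≤ w l) :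
    ∃ ρ : ℝ, 0 < ρ ∧ ∀ M : ℤ → ℤ → ℂ, (∀ l, Summable fun j => ‖M j l‖ * w j) →
      (∀ l, ∑' j, ‖M j l‖ * w j ≤ ρ * w l) →
      ∃ X : S → ℤ → ℂ, (∀ a, Summable fun l => ‖X a l‖ * w l) ∧ (∀ a, ∀ l ∈ S, X a l = 0) ∧
        ∀ a : S, ∀ l ∉ S, ((g l : ℂ) - g a) * X a l =
          ∑ b : S, (∑' m, M b m * ((if m = a then 1 else 0) + X a m)) * X b l
            - ∑' m, M l m * ((if m = a then 1 else 0) + X a m) := by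
  have hw0 : ∀ l, 0 < w l := fun l => zero_lt_one.trans_le (hw l)
  have hwC : ∀ l, (w l : ℂ) ≠ 0 := fun l => by exact_mod_cast (hw0 l).ne'
  let δ : S → ℤ → ℂ := fun a l => if l ∈ S then 0 else ((g l : ℂ) - g a)⁻¹
  have hδ : ∀ (a : S) l, ‖δ a l‖ ≤ γ⁻¹ := by
    intro a l
    by_cases hl : l ∈ S
    · simpa [δ, hl] using hγ.le
    · simp only [δ, hl, if_false, norm_inv, ← Complex.ofReal_sub, Complex.norm_real]
      exact inv_anti₀ hγ (hg a a.2 l hl)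
  have hδ' : ∀ (a : S) l, ‖ContinuousLinearMap.toSpanSingleton ℂ (δ a l)‖ ≤ γ⁻¹ := fun a l => by
    rw [ContinuousLinearMap.norm_toSpanSingleton]; exact hδ a l
  let D : S → ℓ^1(ℤ, ℂ) →L[ℂ] ℓ^1(ℤ, ℂ) := fun a =>
    lp.mapCLM 1 (fun l => ContinuousLinearMap.toSpanSingleton ℂ (δ a l)) (inv_nonneg.2 hγ.le)
      (hδ' a)
  let e : S → ℓ^1(ℤ, ℂ) := fun a => lp.single 1 (a : ℤ) (w a : ℂ)
  let ev : S → ℓ^1(ℤ, ℂ) →L[ℂ] ℂ := fun b =>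
    ((w b : ℂ)⁻¹) • lp.evalCLM ℂ (fun _ : ℤ => ℂ) 1 (b : ℤ)
  have he : ∀ a, ‖e a‖ ≤ ∑ b : S, w b := fun a => by
    rw [lp.norm_single (by simp), Complex.norm_real, Real.norm_of_nonneg (hw0 _).le]
    exact Finset.single_le_sum (f := fun b : S => w b) (fun b _ => (hw0 b).le) (Finset.mem_univ a)
  have hev : ∀ b, ‖ev b‖ ≤ 1 := fun b => by
    refine ContinuousLinearMap.opNorm_le_bound _ zero_le_one fun y => ?_
    have h1 : ‖y (b : ℤ)‖ ≤ ‖y‖ := lp.norm_apply_le_norm one_ne_zero y b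
    have h2 : ‖(w b : ℂ)⁻¹‖ ≤ 1 := by
      rw [norm_inv, Complex.norm_real, Real.norm_of_nonneg (hw0 _).le]
      exact inv_le_one_of_one_le₀ (hw b)
    calc ‖ev b y‖ = ‖(w b : ℂ)⁻¹‖ * ‖y (b : ℤ)‖ := norm_mul _ _
      _ ≤ 1 * ‖y‖ := by gcongr
  obtain ⟨ρ, hρ, H⟩ := exists_riccati_fixedPoint (inv_nonneg.2 hγ.le)
    (Finset.sum_nonneg fun b _ => (hw0 _).le) D (fun a => lp.norm_mapCLM_le 1 _ _ _) e he ev hev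
  refine ⟨ρ, hρ, fun M hMs hM => ?_⟩
  have hNn : ∀ j l, ‖(w j : ℂ) * M j l / w l‖ = ‖M j l‖ * w j / w l := fun j l => by
    rw [norm_div, norm_mul, Complex.norm_real, Complex.norm_real,
      Real.norm_of_nonneg (hw0 _).le, Real.norm_of_nonneg (hw0 _).le, mul_comm (w j)]
  obtain ⟨A, hA, hAy⟩ := exists_clm_of_columns (N := fun j l => (w j : ℂ) * M j l / w l) hρ.le
    (fun l => by simp_rw [hNn]; exact (hMs l).div_const _)
    (fun l => by
      simp_rw [hNn]
      rw [tsum_div_const, div_le_iff₀ (hw0 l)]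
      exact hM l)
  obtain ⟨Y, hY⟩ := H A hA
  have hYs : ∀ a, Summable fun l => ‖Y a l‖ := fun a => by simpa using (Y a).2.summable
  have hAz : ∀ (a : S) j, A (e a + Y a) j =
      w j * ∑' m, M j m * ((if m = a then 1 else 0) + Y a m / w m) := by
    intro a j
    rw [hAy, ← tsum_mul_left]
    refine tsum_congr fun m => ?_
    have : (e a + Y a) m = (if m = a then (w m : ℂ) else 0) + Y a m := by
      rw [lp.coeFn_add, Pi.add_apply, lp.single_apply]
      congr 1
      by_cases h : m = a
      · subst h; simp
      · simp [h]
    rw [this]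
    have := hwC m
    split_ifs <;> (field_simp; try ring)
  have hYl : ∀ (a : S) l, Y a l = δ a l * (∑ b : S,
      (∑' m, M b m * ((if m = a then 1 else 0) + Y a m / w m)) * Y b l -
        w l * ∑' m, M l m * ((if m = a then 1 else 0) + Y a m / w m)) := by
    intro a l
    have h1 : Y a l = (∑ b, ev b (A (e a + Y a)) • Y b - A (e a + Y a) : ℓ^1(ℤ, ℂ)) l * δ a l :=
      congrArg (fun y : ℓ^1(ℤ, ℂ) => y l) (hY a)
    rw [h1, lp.coeFn_sub, Pi.sub_apply, hAz, lp.coeFn_sum, Finset.sum_apply, mul_comm]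
    congr 2
    refine Finset.sum_congr rfl fun b _ => ?_
    have h2 : ev b (A (e a + Y a)) = (w b : ℂ)⁻¹ * (A (e a + Y a)) b := rfl
    rw [lp.coeFn_smul, Pi.smul_apply, smul_eq_mul, h2, hAz, inv_mul_cancel_left₀ (hwC b)]
  refine ⟨fun a l => Y a l / w l, fun a => ?_, fun a l hl => ?_, fun a l hl => ?_⟩
  · refine (hYs a).congr fun l => ?_
    rw [norm_div, Complex.norm_real, Real.norm_of_nonneg (hw0 _).le, div_mul_cancel₀ _ (hw0 l).ne']
  · simp [hYl a l, δ, hl]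
  · have hne : (g l : ℂ) - g a ≠ 0 := by
      rw [← Complex.ofReal_sub, Complex.ofReal_ne_zero]
      exact abs_pos.1 (hγ.trans_le (hg a a.2 l hl))
    dsimp only
    rw [hYl a l]
    simp only [δ, hl, if_false]
    have := hwC l
    simp_rw [mul_div_assoc', ← Finset.sum_div]
    field_simp
lemma matPow_finiteRank {κ : Type*} [Fintype κ] [DecidableEq κ] (μ : κ → ℂ) (F G : κ → ℤ → ℂ)
    (c : κ → κ → ℂ) (h : ∀ α β, HasSum (fun l => G α l * F β l) (c α β))
    (hc : ∀ α β, c α β * μ β = if α = β then μ β else 0) (m : ℕ) (j k : ℤ) :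
    matPow (fun j k => ∑ α, μ α * (F α j * G α k)) m j k
      = ∑ α, μ α ^ (m + 1) * (F α j * G α k) := by
  induction m generalizing j k with
  | zero => simp [matPow]
  | succ m ih =>
    simp only [matPow, ih]
    have h1 : HasSum (fun l => ∑ α, ∑ β,
        (μ α ^ (m + 1) * F α j * μ β * G β k) * (G α l * F β l))
        (∑ α, ∑ β, (μ α ^ (m + 1) * F α j * μ β * G β k) * c α β) :=
      hasSum_sum fun α _ => hasSum_sum fun β _ => (h α β).mul_left _
    have h2 : (∑ α, ∑ β, (μ α ^ (m + 1) * F α j * μ β * G β k) * c α β)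
        = ∑ α, μ α ^ (m + 1 + 1) * (F α j * G α k) := by
      refine Finset.sum_congr rfl fun α _ => ?_
      have h3 : ∀ β, (μ α ^ (m + 1) * F α j * μ β * G β k) * c α β
          = if α = β then μ α ^ (m + 1 + 1) * (F α j * G α k) else 0 := fun β => by
        rw [show (μ α ^ (m + 1) * F α j * μ β * G β k) * c α β
          = (μ α ^ (m + 1) * F α j * G β k) * (c α β * μ β) by ring, hc]
        split_ifs with hαβ
        · subst hαβ; ring
        · ring
      simp [h3]
    rw [← h2, ← h1.tsum_eq]
    refine tsum_congr fun l => ?_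
    rw [Finset.sum_mul_sum]
    exact Finset.sum_congr rfl fun α _ => Finset.sum_congr rfl fun β _ => by ring

/-- The exponential of a diagonalizable matrix of finite rank. -/
lemma matExp_finiteRank {κ : Type*} [Fintype κ] [DecidableEq κ] (μ : κ → ℂ) (F G : κ → ℤ → ℂ)
    (c : κ → κ → ℂ) (h : ∀ α β, HasSum (fun l => G α l * F β l) (c α β))
    (hc : ∀ α β, c α β * μ β = if α = β then μ β else 0) (j k : ℤ) :
    matExp (fun j k => ∑ α, μ α * (F α j * G α k)) j k
      = (if j = k then 1 else 0) + ∑ α, (Complex.exp (μ α) - 1) * (F α j * G α k) := by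
  have hexp : ∀ z : ℂ, HasSum (fun m : ℕ => z ^ (m + 1) / ((m + 1).factorial : ℂ))
      (Complex.exp z - 1) := fun z => by
    have := NormedSpace.expSeries_div_hasSum_exp (𝔸 := ℂ) z
    rw [← Complex.exp_eq_exp_ℂ] at this
    simpa using (hasSum_nat_add_iff' 1).2 this
  have h1 : HasSum (fun m : ℕ => ∑ α, μ α ^ (m + 1) / ((m + 1).factorial : ℂ) * (F α j * G α k))
      (∑ α, (Complex.exp (μ α) - 1) * (F α j * G α k)) :=
    hasSum_sum fun α _ => (hexp (μ α)).mul_right _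
  unfold matExp
  rw [← h1.tsum_eq]
  congr 1
  refine tsum_congr fun m => ?_
  rw [matPow_finiteRank μ F G c h hc, Finset.sum_div]
  exact Finset.sum_congr rfl fun α _ => by ring

open ComplexConjugate in
/-- A finite family in `ℓ¹(ℤ)` has a singular value decomposition. -/
lemma exists_singular_decomposition {ι : Type*} [Fintype ι] [DecidableEq ι] (X : ι → ℤ → ℂ)
    (hX : ∀ a, Summable fun l => ‖X a l‖) :
    ∃ (U : Matrix ι ι ℂ) (s : ι → ℝ) (u : ι → ℤ → ℂ) (c : ι → ι → ℂ),
      U ∈ Matrix.unitaryGroup ι ℂ ∧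
      (∀ i l, ∑ a, U a i * X a l = s i * u i l) ∧
      (∀ i l, u i l = ∑ a, c i a * X a l) ∧
      ∀ i j, s j ≠ 0 → HasSum (fun l => conj (u i l) * u j l) (if i = j then 1 else 0) := by
  have hprod : ∀ a b, Summable fun l => conj (X a l) * X b l := fun a b => by
    refine Summable.of_norm_bounded (g := fun l => (∑' m, ‖X a m‖) * ‖X b l‖)
      ((hX b).mul_left _) fun l => ?_
    rw [norm_mul, RCLike.norm_conj]
    gcongr
    exact (hX a).le_tsum l fun _ _ => norm_nonneg _
  let H : Matrix ι ι ℂ := Matrix.of fun a b => ∑' l, conj (X a l) * X b l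
  have hH : H.IsHermitian := by
    ext a b
    rw [Matrix.conjTranspose_apply, ← starRingEnd_apply]
    simp only [H, Matrix.of_apply]
    rw [Complex.conj_tsum]
    exact tsum_congr fun l => by simp [mul_comm]
  let U : Matrix ι ι ℂ := hH.eigenvectorUnitary
  let x : ι → ℤ → ℂ := fun i l => ∑ a, U a i * X a l
  let s : ι → ℝ := fun i => Real.sqrt (hH.eigenvalues i)
  have hUU : star U * U = 1 := (Matrix.mem_unitaryGroup_iff').1 hH.eigenvectorUnitary.2
  have hdiag : star U * H * U = Matrix.diagonal (fun i => (hH.eigenvalues i : ℂ)) := by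
    have h1 : H = U * Matrix.diagonal (fun i => (hH.eigenvalues i : ℂ)) * star U := by
      have := hH.spectral_theorem
      rw [Unitary.conjStarAlgAut_apply] at this
      exact this
    calc star U * H * U
        = star U * (U * Matrix.diagonal (fun i => (hH.eigenvalues i : ℂ)) * star U) * U := by
          rw [← h1]
      _ = (star U * U) * Matrix.diagonal (fun i => (hH.eigenvalues i : ℂ)) * (star U * U) := by
          simp only [Matrix.mul_assoc]
      _ = _ := by rw [hUU, Matrix.one_mul, Matrix.mul_one]
  have hxx : ∀ i j, HasSum (fun l => conj (x i l) * x j l)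
      (if i = j then (hH.eigenvalues i : ℂ) else 0) := by
    intro i j
    have h1 : HasSum (fun l => ∑ a, ∑ b, conj (U a i) * U b j * (conj (X a l) * X b l))
        (∑ a, ∑ b, conj (U a i) * U b j * H a b) :=
      hasSum_sum fun a _ => hasSum_sum fun b _ => (hprod a b).hasSum.mul_left _
    have h2 : (∑ a, ∑ b, conj (U a i) * U b j * H a b) =
        if i = j then (hH.eigenvalues i : ℂ) else 0 := by
      have h3 := congrFun (congrFun hdiag i) j
      rw [Matrix.diagonal_apply] at h3
      rw [← h3, Matrix.mul_apply, Finset.sum_comm]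
      refine Finset.sum_congr rfl fun b _ => ?_
      rw [Matrix.mul_apply, Finset.sum_mul]
      refine Finset.sum_congr rfl fun a _ => ?_
      rw [Matrix.star_apply, starRingEnd_apply]
      ring
    rw [← h2]
    convert h1 using 2 with l
    simp only [x, map_sum, map_mul]
    rw [Finset.sum_mul_sum]
    exact Finset.sum_congr rfl fun a _ => Finset.sum_congr rfl fun b _ => by ring
  have hsq : ∀ i, HasSum (fun l => ‖x i l‖ ^ 2) (hH.eigenvalues i) := fun i => by
    have := hxx i i
    simp only [if_true, Complex.conj_mul'] at this
    exact_mod_cast this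
  have hnn : ∀ i, 0 ≤ hH.eigenvalues i := fun i => (hsq i).nonneg fun l => by positivity
  have hss : ∀ i, (s i : ℂ) * s i = hH.eigenvalues i := fun i => by
    rw [← Complex.ofReal_mul, Real.mul_self_sqrt (hnn i)]
  refine ⟨U, s, fun i l => (s i : ℂ)⁻¹ * x i l, fun i a => (s i : ℂ)⁻¹ * U a i,
    hH.eigenvectorUnitary.2, fun i l => ?_, fun i l => ?_, fun i j hj => ?_⟩
  · by_cases hs : s i = 0
    · have h0 : hH.eigenvalues i = 0 := by exact_mod_cast (by rw [← hss, hs]; simp :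
        (hH.eigenvalues i : ℂ) = 0)
      have h1 := hsq i
      rw [h0, hasSum_zero_iff_of_nonneg fun l => by positivity] at h1
      have h2 : x i l = 0 := by simpa using congrFun h1 l
      simpa [hs] using h2
    · rw [mul_inv_cancel_left₀ (by exact_mod_cast hs)]
  · simp only [x, Finset.mul_sum, mul_assoc]
  · have h1 : ∀ l, conj ((s i : ℂ)⁻¹ * x i l) * ((s j : ℂ)⁻¹ * x j l) =
        (s i : ℂ)⁻¹ * (s j : ℂ)⁻¹ * (conj (x i l) * x j l) := fun l => by
      rw [map_mul, map_inv₀, Complex.conj_ofReal]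
      ring
    have h2 : (if i = j then (1 : ℂ) else 0) = (s i : ℂ)⁻¹ * (s j : ℂ)⁻¹ *
        (if i = j then (hH.eigenvalues i : ℂ) else 0) := by
      split_ifs with hij
      · subst hij
        rw [← hss]
        have : (s i : ℂ) ≠ 0 := by exact_mod_cast hj
        field_simp
      · simp
    simp only [h1, h2]
    exact (hxx i j).mul_left _

open ComplexConjugate in
/-- The generator `∑ φᵢ (uᵢ vᵢ* - vᵢ uᵢ*)` of the rotation by the angles `φᵢ` in the planes
spanned by `uᵢ` and `vᵢ`. -/
noncomputable def rotationGenerator {ι : Type*} [Fintype ι] (φ : ι → ℝ) (u v : ι → ℤ → ℂ)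
    (j k : ℤ) : ℂ :=
  ∑ i, (φ i : ℂ) * (u i j * conj (v i k) - v i j * conj (u i k))

open ComplexConjugate in
lemma matExp_rotationGenerator {ι : Type*} [Fintype ι] [DecidableEq ι] (φ : ι → ℝ)
    (u v : ι → ℤ → ℂ) (huv : ∀ i j l, u i l = 0 ∨ v j l = 0) (c : ι → ι → ℂ)
    (hu : ∀ i j, HasSum (fun l => conj (u i l) * u j l) (c i j))
    (hc : ∀ i j, φ j ≠ 0 → c i j = if i = j then 1 else 0)
    (hv : ∀ i j, HasSum (fun l => conj (v i l) * v j l) (if i = j then 1 else 0)) (j k : ℤ) :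
    matExp (rotationGenerator φ u v) j k = (if j = k then 1 else 0) +
      ∑ i, ((Real.cos (φ i) - 1 : ℂ) * (u i j * conj (u i k) + v i j * conj (v i k))
        + Real.sin (φ i) * (u i j * conj (v i k) - v i j * conj (u i k))) := by
  let σ : Bool → ℂ := fun b => if b then 1 else -1
  let μ : ι × Bool → ℂ := fun α => (φ α.1 : ℂ) * (σ α.2 * Complex.I)
  let F : ι × Bool → ℤ → ℂ := fun α l => u α.1 l + σ α.2 * Complex.I * v α.1 l
  let G : ι × Bool → ℤ → ℂ := fun α l => (1 / 2) * conj (F α l)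
  let C : ι × Bool → ι × Bool → ℂ := fun α β =>
    1 / 2 * c α.1 β.1 + 1 / 2 * (σ α.2 * σ β.2) * (if α.1 = β.1 then 1 else 0)
  have hσ : ∀ b, conj (σ b) = σ b := fun b => by cases b <;> simp [σ]
  have hGF : ∀ α β, HasSum (fun l => G α l * F β l) (C α β) := fun α β => by
    have h1 := ((hu α.1 β.1).mul_left (1 / 2)).add ((hv α.1 β.1).mul_left
      (1 / 2 * (σ α.2 * σ β.2)))
    refine h1.congr_fun fun l => ?_
    have z1 : conj (u α.1 l) * v β.1 l = 0 := by
      rcases huv α.1 β.1 l with h | h <;> simp [h]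
    have z2 : conj (v α.1 l) * u β.1 l = 0 := by
      rcases huv β.1 α.1 l with h | h <;> simp [h]
    simp only [F, G, map_add, map_mul, hσ, Complex.conj_I]
    linear_combination (1 / 2 * σ β.2 * Complex.I) * z1 - (1 / 2 * σ α.2 * Complex.I) * z2
      - (1 / 2 * (σ α.2 * σ β.2) * conj (v α.1 l) * v β.1 l) * Complex.I_sq
  have hC : ∀ α β, C α β * μ β = if α = β then μ β else 0 := by
    rintro ⟨i, s⟩ ⟨i', t⟩
    by_cases h0 : φ i' = 0
    · simp [μ, h0]
    · simp only [C, μ, hc i i' h0, σ, Prod.mk.injEq]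
      by_cases hi : i = i'
      · subst hi
        cases s <;> cases t <;> norm_num
      · simp [hi]
  have hT : rotationGenerator φ u v = fun j k => ∑ α, μ α * (F α j * G α k) := by
    ext j k
    rw [Fintype.sum_prod_type]
    refine Finset.sum_congr rfl fun i _ => ?_
    simp only [Fintype.sum_bool, μ, F, G, map_add, map_mul, hσ, Complex.conj_I]
    simp only [σ, if_true, Bool.false_eq_true, if_false]
    linear_combination ((φ i : ℂ) * (u i j * conj (v i k) - v i j * conj (u i k))) * Complex.I_sq
  rw [hT, matExp_finiteRank μ F G C hGF hC, Fintype.sum_prod_type]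
  congr 1
  refine Finset.sum_congr rfl fun i _ => ?_
  have e1 : Complex.exp (μ (i, true)) = Real.cos (φ i) + Real.sin (φ i) * Complex.I := by
    simp only [μ, σ, if_true, one_mul]
    rw [Complex.exp_mul_I, Complex.ofReal_cos, Complex.ofReal_sin]
  have e2 : Complex.exp (μ (i, false)) = Real.cos (φ i) - Real.sin (φ i) * Complex.I := by
    simp only [μ, σ, Bool.false_eq_true, if_false]
    rw [show (φ i : ℂ) * (-1 * Complex.I) = (-φ i : ℂ) * Complex.I by ring, Complex.exp_mul_I,
      Complex.cos_neg, Complex.sin_neg, Complex.ofReal_cos, Complex.ofReal_sin]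
    ring
  simp only [Fintype.sum_bool, e1, e2, F, G, map_add, map_mul, hσ, Complex.conj_I]
  simp only [σ, if_true, Bool.false_eq_true, if_false]
  linear_combination (-(Real.sin (φ i) : ℂ) * (u i j * conj (v i k) - v i j * conj (u i k)) -
   (Real.cos (φ i) - 1 : ℂ) * v i j * conj (v i k)) * Complex.I_sq

open ComplexConjugate in
/-- There is an anti-Hermitian `T`, coupling only `S` with its complement, whose exponential maps
the coordinate space of `S` onto the span of the vectors `e_a + X_a`. -/
lemma exists_rotation_onto_graph (S : Finset ℤ) (w : ℤ → ℝ) (hw : ∀ l, 1 ≤ w l)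
    (X : S → ℤ → ℂ) (hX : ∀ a, Summable fun l => ‖X a l‖ * w l) (hX0 : ∀ a, ∀ l ∈ S, X a l = 0) :
    ∃ (T : ℤ → ℤ → ℂ) (B : ℤ → ℝ) (κ : S → S → ℂ),
      (∀ j k, T j k = -conj (T k j)) ∧
      (∀ j k, ¬ Xor (j ∈ S) (k ∈ S) → T j k = 0) ∧
      (∀ l, 0 ≤ B l) ∧ (Summable fun l => B l * w l) ∧
      (∀ j k, ‖T j k‖ ≤ B j * B k) ∧
      (∀ j k, ‖matExp T j k - if j = k then 1 else 0‖ ≤ B j * B k) ∧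
      (∀ j k, matExp (fun a b => -T a b) j k = conj (matExp T k j)) ∧
      (∀ j, ∀ k : S, matExp T j k = ∑ a, κ a k * ((if j = a then 1 else 0) + X a j)) ∧
      ∀ j ∉ S, ∀ a : S, HasSum (fun l => matExp (fun a b => -T a b) j l *
        ((if l = (a : ℤ) then 1 else 0) + X a l)) 0 := by
  have hX1 : ∀ a, Summable fun l => ‖X a l‖ := fun a =>
    (hX a).of_nonneg_of_le (fun _ => norm_nonneg _) fun l =>
      le_mul_of_one_le_right (norm_nonneg _) (hw l)
  obtain ⟨U, s, u, c, hU, hUX, huX, huu⟩ := exists_singular_decomposition X hX1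
  let v : S → ℤ → ℂ := fun i l => if h : l ∈ S then U ⟨l, h⟩ i else 0
  have hvS : ∀ i (l : S), v i l = U l i := fun i l => by simp [v]
  have hvn : ∀ i, ∀ l ∉ S, v i l = 0 := fun i l hl => by simp [v, hl]
  have huS : ∀ i, ∀ l ∈ S, u i l = 0 := fun i l hl => by simp [huX, hX0 _ l hl]
  have huv : ∀ i j l, u i l = 0 ∨ v j l = 0 := fun i j l => by
    by_cases hl : l ∈ S
    · exact Or.inl (huS i l hl)
    · exact Or.inr (hvn j l hl)
  have huw : ∀ i, Summable fun l => ‖u i l‖ * w l := fun i => by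
    refine Summable.of_nonneg_of_le (fun l => mul_nonneg (norm_nonneg _) (zero_le_one.trans (hw l)))
      (fun l => ?_) (summable_sum (s := Finset.univ) fun a _ => (hX a).mul_left ‖c i a‖)
    rw [huX]
    calc ‖∑ a, c i a * X a l‖ * w l ≤ (∑ a, ‖c i a‖ * ‖X a l‖) * w l := by
          gcongr
          · exact zero_le_one.trans (hw l)
          · exact norm_sum_le_of_le _ fun a _ => (norm_mul _ _).le
      _ = _ := by rw [Finset.sum_mul]; exact Finset.sum_congr rfl fun a _ => by ring
  have hvw : ∀ i, Summable fun l => ‖v i l‖ * w l := fun i =>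
    summable_of_ne_finset_zero (s := S) fun l hl => by simp [hvn i l hl]
  have hu1 : ∀ i, Summable fun l => ‖u i l‖ := fun i =>
    (huw i).of_nonneg_of_le (fun _ => norm_nonneg _) fun l =>
      le_mul_of_one_le_right (norm_nonneg _) (hw l)
  have hus : ∀ i j, Summable fun l => conj (u i l) * u j l := fun i j => by
    refine Summable.of_norm_bounded (g := fun l => (∑' m, ‖u i m‖) * ‖u j l‖)
      ((hu1 j).mul_left _) fun l => ?_
    rw [norm_mul, RCLike.norm_conj]
    gcongr
    exact (hu1 i).le_tsum l fun _ _ => norm_nonneg _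
  let d : S → S → ℂ := fun i j => ∑' l, conj (u i l) * u j l
  have hd : ∀ i j, HasSum (fun l => conj (u i l) * u j l) (d i j) := fun i j => (hus i j).hasSum
  have hds : ∀ i j, s j ≠ 0 → d i j = if i = j then 1 else 0 := fun i j hj =>
    (huu i j hj).tsum_eq
  have hvv : ∀ i j, HasSum (fun l => conj (v i l) * v j l) (if i = j then 1 else 0) := by
    intro i j
    have h1 : HasSum (fun l => conj (v i l) * v j l) (∑ l ∈ S, conj (v i l) * v j l) :=
      hasSum_sum_of_ne_finset_zero fun l hl => by simp [hvn j l hl]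
    convert h1 using 1
    have h2 := congrFun (congrFun ((Matrix.mem_unitaryGroup_iff').1 hU) i) j
    rw [Matrix.one_apply, Matrix.mul_apply] at h2
    rw [← h2, ← Finset.sum_coe_sort S (fun l => conj (v i l) * v j l)]
    exact Finset.sum_congr rfl fun l _ => by rw [hvS, hvS, Matrix.star_apply, starRingEnd_apply]
  have hUU : ∀ a b, ∑ i, U a i * conj (U b i) = if a = b then 1 else 0 := fun a b => by
    have h2 := congrFun (congrFun ((Matrix.mem_unitaryGroup_iff).1 hU) a) b
    rw [Matrix.one_apply, Matrix.mul_apply] at h2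
    rw [← h2]
    exact Finset.sum_congr rfl fun i _ => by rw [Matrix.star_apply, starRingEnd_apply]
  let φ : S → ℝ := fun i => Real.arctan (s i)
  have hφs : ∀ i, φ i ≠ 0 → s i ≠ 0 := fun i h h0 => h (by simp [φ, h0])
  have hcs : ∀ i, (Real.cos (φ i) : ℂ) * s i = Real.sin (φ i) := fun i => by
    have h1 : Real.cos (φ i) ≠ 0 := (Real.cos_arctan_pos _).ne'
    have h2 : s i = Real.sin (φ i) / Real.cos (φ i) := by
      rw [← Real.tan_eq_sin_div_cos, Real.tan_arctan]
    rw [← Complex.ofReal_mul]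
    congr 1
    rw [h2, mul_div_cancel₀ _ h1]
  have hE := matExp_rotationGenerator φ u v huv d hd (fun i j h => hds i j (hφs j h)) hvv
  have hneg : (fun a b => -rotationGenerator φ u v a b) = rotationGenerator (fun i => -φ i) u v := by
    ext a b
    simp [rotationGenerator, Finset.sum_neg_distrib]
  have hE' := matExp_rotationGenerator (fun i => -φ i) u v huv d hd
    (fun i j h => hds i j (hφs j (neg_ne_zero.1 h))) hvv
  simp only [Real.cos_neg, Real.sin_neg, Complex.ofReal_neg] at hE'
  let z : S → ℤ → ℂ := fun a l => (if l = a then 1 else 0) + X a l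
  have hz : ∀ i l, ∑ a, U a i * z a l = v i l + s i * u i l := fun i l => by
    simp only [z, mul_add, Finset.sum_add_distrib, hUX]
    congr 1
    by_cases hl : l ∈ S
    · lift l to S using hl
      simp [hvS]
    · rw [hvn i l hl]
      refine Finset.sum_eq_zero fun a _ => ?_
      rw [if_neg (fun h : l = (a : ℤ) => hl (h ▸ a.2)), mul_zero]
  have hz' : ∀ a l, z a l = ∑ i, conj (U a i) * (v i l + s i * u i l) := fun a l => by
    simp_rw [← hz, Finset.mul_sum]
    rw [Finset.sum_comm]
    have : ∀ b, ∑ i, conj (U a i) * (U b i * z b l) = if b = a then z a l else 0 := fun b => by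
      have h1 : ∑ i, conj (U a i) * (U b i * z b l) = (∑ i, U b i * conj (U a i)) * z b l := by
        rw [Finset.sum_mul]; exact Finset.sum_congr rfl fun i _ => by ring
      rw [h1, hUU]
      split_ifs with h
      · subst h; rw [one_mul]
      · rw [zero_mul]
    rw [Finset.sum_congr rfl fun b _ => this b]
    simp
  let β : S → ℤ → ℝ := fun i l => ‖u i l‖ + ‖v i l‖
  have hβ : ∀ i l, 0 ≤ β i l := fun i l => by positivity
  have hBB : ∀ (f : S → ℂ) j k, (∀ i, ‖f i‖ ≤ 4 * (β i j * β i k)) →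
      ‖∑ i, f i‖ ≤ (2 * ∑ i, β i j) * (2 * ∑ i, β i k) := fun f j k hf => by
    calc ‖∑ i, f i‖ ≤ ∑ i, 4 * (β i j * β i k) := norm_sum_le_of_le _ fun i _ => hf i
      _ ≤ ∑ i, 4 * (β i j * ∑ i', β i' k) := by
          refine Finset.sum_le_sum fun i _ => ?_
          have := Finset.single_le_sum (f := fun i => β i k) (fun i _ => hβ i k)
            (Finset.mem_univ i)
          have h0 := hβ i j
          gcongr
      _ = _ := by rw [← Finset.mul_sum, ← Finset.sum_mul]; ring
  have hx : ∀ i j k, ‖u i j * conj (v i k) - v i j * conj (u i k)‖ ≤ β i j * β i k :=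
    fun i j k => by
      refine (norm_sub_le _ _).trans ?_
      simp only [norm_mul, RCLike.norm_conj, β]
      nlinarith [mul_nonneg (norm_nonneg (u i j)) (norm_nonneg (u i k)),
        mul_nonneg (norm_nonneg (v i j)) (norm_nonneg (v i k))]
  have hx' : ∀ i j k, ‖u i j * conj (u i k) + v i j * conj (v i k)‖ ≤ β i j * β i k :=
    fun i j k => by
      refine (norm_add_le _ _).trans ?_
      simp only [norm_mul, RCLike.norm_conj, β]
      nlinarith [mul_nonneg (norm_nonneg (u i j)) (norm_nonneg (v i k)),
        mul_nonneg (norm_nonneg (v i j)) (norm_nonneg (u i k))]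
  refine ⟨rotationGenerator φ u v, fun l => 2 * ∑ i, β i l,
    fun a k => ∑ i, Real.cos (φ i) * conj (U k i) * U a i, fun j k => ?_, fun j k hjk => ?_,
    fun l => mul_nonneg zero_le_two (Finset.sum_nonneg fun i _ => hβ i l), ?_, fun j k => ?_,
    fun j k => ?_, fun j k => ?_, fun j k => ?_, fun j hj a => ?_⟩
  · simp only [rotationGenerator, map_sum, ← Finset.sum_neg_distrib]
    refine Finset.sum_congr rfl fun i _ => ?_
    simp only [map_mul, map_sub, Complex.conj_ofReal, Complex.conj_conj]
    ring
  · refine Finset.sum_eq_zero fun i _ => ?_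
    by_cases hj : j ∈ S <;> by_cases hk : k ∈ S
    · simp [huS i j hj, huS i k hk]
    · exact absurd (Or.inl ⟨hj, hk⟩) hjk
    · exact absurd (Or.inr ⟨hk, hj⟩) hjk
    · simp [hvn i j hj, hvn i k hk]
  · have : Summable fun l => ∑ i, 2 * (‖u i l‖ * w l + ‖v i l‖ * w l) :=
      summable_sum fun i _ => ((huw i).add (hvw i)).mul_left 2
    refine this.congr fun l => ?_
    change _ = (2 * ∑ i, β i l) * w l
    rw [Finset.mul_sum, Finset.sum_mul]
    exact Finset.sum_congr rfl fun i _ => by simp only [β]; ring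
  · refine hBB _ j k fun i => ?_
    rw [norm_mul, Complex.norm_real, Real.norm_eq_abs]
    have h1 : |φ i| ≤ 4 := by
      have h2 := Real.arctan_lt_pi_div_two (s i)
      have h3 := Real.neg_pi_div_two_lt_arctan (s i)
      have h4 := Real.pi_lt_four
      exact abs_le.2 ⟨by simp only [φ]; linarith, by simp only [φ]; linarith⟩
    exact mul_le_mul h1 (hx i j k) (norm_nonneg _) (by norm_num)
  · rw [hE, add_sub_cancel_left]
    refine hBB _ j k fun i => ?_
    have h1 : ‖(Real.cos (φ i) - 1 : ℂ)‖ ≤ 2 := by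
      refine (norm_sub_le _ _).trans ?_
      rw [Complex.norm_real, norm_one, Real.norm_eq_abs]
      linarith [Real.abs_cos_le_one (φ i)]
    have h2 : ‖(Real.sin (φ i) : ℂ)‖ ≤ 1 := by
      rw [Complex.norm_real]; exact Real.abs_sin_le_one _
    refine (norm_add_le _ _).trans ?_
    rw [norm_mul, norm_mul]
    have h3 := mul_le_mul h1 (hx' i j k) (norm_nonneg _) (by norm_num)
    have h4 := mul_le_mul h2 (hx i j k) (norm_nonneg _) (by norm_num)
    have h5 := mul_nonneg (hβ i j) (hβ i k)
    linarith
  · rw [hneg, hE', hE]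
    simp only [map_add, map_sum, map_mul, map_sub, Complex.conj_ofReal, Complex.conj_conj, map_one]
    congr 1
    · by_cases h : j = k
      · simp [h]
      · simp [h, Ne.symm h]
    · exact Finset.sum_congr rfl fun i _ => by ring
  · have h1 : ∑ i, v i j * conj (v i k) = if j = k then 1 else 0 := by
      by_cases hj : j ∈ S
      · lift j to S using hj
        simp only [hvS, hUU, Subtype.ext_iff]
      · rw [if_neg (fun h : j = (k : ℤ) => hj (h ▸ k.2))]
        exact Finset.sum_eq_zero fun i _ => by rw [hvn i j hj, zero_mul]
    have h2 : ∑ a, (∑ i, Real.cos (φ i) * conj (U k i) * U a i) * z a j =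
        ∑ i, Real.cos (φ i) * conj (U k i) * (v i j + s i * u i j) := by
      simp_rw [← hz, Finset.sum_mul, Finset.mul_sum]
      rw [Finset.sum_comm]
      exact Finset.sum_congr rfl fun i _ => Finset.sum_congr rfl fun a _ => by ring
    rw [hE, ← h1, ← Finset.sum_add_distrib]
    refine Eq.trans ?_ h2.symm
    refine Finset.sum_congr rfl fun i _ => ?_
    rw [huS i k k.2, hvS, map_zero]
    linear_combination (-conj (U k i) * u i j) * hcs i
  · have hy : ∀ i, HasSum (fun l => matExp (fun a b => -rotationGenerator φ u v a b) j l *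
        (v i l + s i * u i l)) 0 := by
      intro i
      have hup : ∀ p, HasSum (fun l => conj (u p l) * (v i l + s i * u i l))
          (if p = i then (s i : ℂ) else 0) := fun p => by
        have h1 := (hd p i).mul_left (s i : ℂ)
        have h2 : (s i : ℂ) * d p i = if p = i then (s i : ℂ) else 0 := by
          by_cases h0 : s i = 0
          · simp [h0]
          · rw [hds p i h0]; split_ifs <;> simp
        rw [h2] at h1
        refine h1.congr_fun fun l => ?_
        rcases huv p i l with h | h <;> simp [h]
        ring
      have hvp : ∀ p, HasSum (fun l => conj (v p l) * (v i l + s i * u i l))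
          (if p = i then 1 else 0) := fun p => by
        refine (hvv p i).congr_fun fun l => ?_
        rcases huv i p l with h | h <;> simp [h]
      have h1 : HasSum (fun l => if l = j then v i l + s i * u i l else 0)
          (v i j + s i * u i j) := by
        simpa using hasSum_ite_eq j (v i j + s i * u i j) |>.congr_fun fun l => by
          split_ifs with h
          · rw [h]
          · rfl
      have h2 := h1.add (hasSum_sum (s := Finset.univ) fun p _ =>
        ((hup p).mul_left ((Real.cos (φ p) - 1 : ℂ) * u p j)).sub
          ((hvp p).mul_left (Real.sin (φ p) * u p j : ℂ)))
      have h3 : v i j + s i * u i j + ∑ p, ((Real.cos (φ p) - 1 : ℂ) * u p j *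
          (if p = i then (s i : ℂ) else 0) -
          Real.sin (φ p) * u p j * (if p = i then 1 else 0)) = 0 := by
        rw [Finset.sum_eq_single i (fun p _ hp => by simp [hp]) (by simp), hvn i j hj]
        simp only [if_true]
        linear_combination u i j * hcs i
      rw [h3] at h2
      refine h2.congr_fun fun l => ?_
      rw [hneg, hE', add_mul, Finset.sum_mul]
      congr 1
      · by_cases h : j = l
        · simp [h]
        · simp [h, Ne.symm h]
      · refine Finset.sum_congr rfl fun p _ => ?_
        rw [hvn p j hj]
        ring
    have h4 := hasSum_sum (s := Finset.univ) fun i _ => (hy i).mul_left (conj (U a i))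
    simp only [mul_zero, Finset.sum_const_zero] at h4
    refine h4.congr_fun fun l => ?_
    change _ * z a l = _
    rw [hz', Finset.mul_sum]
    exact Finset.sum_congr rfl fun i _ => by ring

/-- Double series against a matrix with uniformly summable columns converge absolutely. -/
lemma summable_mul_columns_mul {M : ℤ → ℤ → ℂ} {K : ℝ} (hs : ∀ m, Summable fun l => ‖M l m‖)
    (hK : ∀ m, ∑' l, ‖M l m‖ ≤ K) {f z : ℤ → ℂ} {C : ℝ} (hf : ∀ l, ‖f l‖ ≤ C)
    (hz : Summable fun m => ‖z m‖) : Summable fun p : ℤ × ℤ => f p.2 * M p.2 p.1 * z p.1 := by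
  have hC : 0 ≤ C := (norm_nonneg _).trans (hf 0)
  have h1 : ∀ m, Summable fun l => C * ‖M l m‖ * ‖z m‖ := fun m =>
    ((hs m).mul_left C).mul_right _
  refine Summable.of_norm_bounded (g := fun p : ℤ × ℤ => C * ‖M p.2 p.1‖ * ‖z p.1‖) ?_ fun p => ?_
  · refine (summable_prod_of_nonneg fun p => by positivity).2 ⟨h1, ?_⟩
    refine Summable.of_nonneg_of_le (fun m => tsum_nonneg fun l => by positivity) (fun m => ?_)
      (hz.mul_left (C * K))
    simp only [tsum_mul_right, tsum_mul_left]
    gcongr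
    exact hK m
  · rw [norm_mul, norm_mul]
    gcongr
    exact hf _

/-- If `g + M` leaves the span of the vectors `z_a` invariant, `E` maps the coordinate vector `e_k`
into this span and the `j`-th row of `E'` annihilates it, then the `(j, k)` entry of
`E' (g + M) E` vanishes. -/
lemma conjugation_entry_eq_zero {ι : Type*} [Fintype ι] {M : ℤ → ℤ → ℂ} {K : ℝ}
    (hs : ∀ m, Summable fun l => ‖M l m‖) (hK : ∀ m, ∑' l, ‖M l m‖ ≤ K) (g f x : ℤ → ℂ)
    {C : ℝ} (hf : ∀ l, ‖f l‖ ≤ C) (z : ι → ℤ → ℂ) (hz : ∀ a, Summable fun l => ‖z a l‖)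
    (N : ι → ι → ℂ) (hN : ∀ a l, g l * z a l + ∑' m, M l m * z a m = ∑ b, N b a * z b l)
    (hfz : ∀ a, HasSum (fun l => f l * z a l) 0) (κ : ι → ℂ) (hx : ∀ l, x l = ∑ a, κ a * z a l) :
    (∑' l, f l * g l * x l) + ∑' l, ∑' m, f l * M l m * x m = 0 := by
  have hMz : ∀ a l, Summable fun m => M l m * z a m := fun a l => by
    have := (summable_mul_columns_mul hs hK (f := fun _ => 1) (C := 1) (by simp)
      (hz a)).prod_symm.prod_factor l
    simpa using this
  have hfMz : ∀ a, Summable fun l => f l * ∑' m, M l m * z a m := fun a => by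
    refine (summable_mul_columns_mul hs hK hf (hz a)).prod_symm.prod.congr fun l => ?_
    rw [← tsum_mul_left]
    exact tsum_congr fun m => mul_assoc _ _ _
  have h1 : ∀ a, HasSum (fun l => f l * g l * z a l) (-∑' l, f l * ∑' m, M l m * z a m) :=
    fun a => by
      have h2 := (hasSum_sum (s := Finset.univ) fun b _ => (hfz b).mul_left (N b a)).sub
        (hfMz a).hasSum
      simp only [mul_zero, Finset.sum_const_zero, zero_sub] at h2
      refine h2.congr_fun fun l => ?_
      have h3 : ∑ b, N b a * (f l * z b l) = f l * ∑ b, N b a * z b l := by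
        rw [Finset.mul_sum]; exact Finset.sum_congr rfl fun b _ => by ring
      rw [h3, ← hN]
      ring
  have h4 : HasSum (fun l => f l * g l * x l)
      (∑ a, κ a * -∑' l, f l * ∑' m, M l m * z a m) := by
    refine (hasSum_sum (s := Finset.univ) fun a _ => (h1 a).mul_left (κ a)).congr_fun fun l => ?_
    rw [hx, Finset.mul_sum]
    exact Finset.sum_congr rfl fun a _ => by ring
  have h5 : ∀ l, ∑' m, f l * M l m * x m = ∑ a, κ a * (f l * ∑' m, M l m * z a m) := fun l => by
    refine HasSum.tsum_eq ((hasSum_sum (s := Finset.univ) fun a _ =>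
      (((hMz a l).hasSum.mul_left (f l)).mul_left (κ a))).congr_fun fun m => ?_)
    rw [hx, Finset.mul_sum]
    exact Finset.sum_congr rfl fun a _ => by ring
  have h6 := hasSum_sum (s := Finset.univ) fun a _ => (hfMz a).hasSum.mul_left (κ a)
  simp_rw [h5]
  rw [h4.tsum_eq, h6.tsum_eq, ← Finset.sum_add_distrib]
  exact Finset.sum_eq_zero fun a _ => by ring

open ComplexConjugate in
/-- Conjugating a Hermitian matrix by `E`, with inverse its adjoint `E'`, gives a Hermitian
matrix. -/
lemma conjugation_entry_conj {M E E' : ℤ → ℤ → ℂ} {K : ℝ} (hM : ∀ j l, M j l = conj (M l j))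
    (hs : ∀ m, Summable fun l => ‖M l m‖) (hK : ∀ m, ∑' l, ‖M l m‖ ≤ K) (g : ℤ → ℝ)
    (hE : ∀ j k, E' j k = conj (E k j)) (j k : ℤ) {C : ℝ} (hC : ∀ l, ‖E' k l‖ ≤ C)
    (hj : Summable fun m => ‖E m j‖) :
    (∑' l, E' j l * g l * E l k) + ∑' l, ∑' m, E' j l * M l m * E m k =
      conj ((∑' l, E' k l * g l * E l j) + ∑' l, ∑' m, E' k l * M l m * E m j) := by
  have hE' : ∀ j k, E j k = conj (E' k j) := fun j k => by rw [hE, Complex.conj_conj]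
  have h1 : Summable (Function.uncurry fun l m => E' k l * M l m * E m j) :=
    (summable_mul_columns_mul hs hK hC hj).prod_symm
  rw [← h1.tsum_comm, map_add, Complex.conj_tsum, Complex.conj_tsum]
  congr 1
  · refine tsum_congr fun l => ?_
    rw [map_mul, map_mul, Complex.conj_ofReal, ← hE, ← hE']
    ring
  · refine tsum_congr fun l => ?_
    rw [Complex.conj_tsum]
    refine tsum_congr fun m => ?_
    rw [map_mul, map_mul, ← hE, ← hE', ← hM]
    ring

/-- A diagonal matrix `g` with a spectral gap between `S` and its complement, perturbed by a small
Hermitian matrix `M`, is block-diagonalised by the exponential of an anti-Hermitian matrix coupling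
only `S` with its complement. -/
lemma exists_block_diagonalisation (S : Finset ℤ) (g : ℤ → ℝ) {γ : ℝ} (hγ : 0 < γ)
    (hg : ∀ a ∈ S, ∀ l ∉ S, γ ≤ |g l - g a|) (w : ℤ → ℝ) (hw : ∀ l, 1 ≤ w l) :
    ∃ ρ : ℝ, 0 < ρ ∧ ∀ M : ℤ → ℤ → ℂ, (∀ j l, M j l = starRingEnd ℂ (M l j)) →
      (∀ l, Summable fun j => ‖M j l‖ * w j) → (∀ l, ∑' j, ‖M j l‖ * w j ≤ ρ * w l) →
      ∀ K, (∀ l, ∑' j, ‖M j l‖ ≤ K) →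
      ∃ (T : ℤ → ℤ → ℂ) (B : ℤ → ℝ), (∀ j k, T j k = -starRingEnd ℂ (T k j)) ∧
        (∀ j k, ¬ Xor (j ∈ S) (k ∈ S) → T j k = 0) ∧
        (∀ l, 0 ≤ B l) ∧ (Summable fun l => B l * w l) ∧ (∀ j k, ‖T j k‖ ≤ B j * B k) ∧
        ∀ j k, Xor (j ∈ S) (k ∈ S) →
          (∑' l, matExp (fun a b => -T a b) j l * g l * matExp T l k) +
            ∑' l, ∑' m, matExp (fun a b => -T a b) j l * M l m * matExp T m k = 0 := by
  obtain ⟨ρ, hρ, H⟩ := exists_invariant_graph S g hγ hg w hw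
  refine ⟨ρ, hρ, fun M hM hMw hMρ K hK => ?_⟩
  obtain ⟨X, hX, hX0, hXe⟩ := H M hMw hMρ
  obtain ⟨T, B, κ, hT, hTS, hB0, hBw, hTB, hEB, hE', hκ, hann⟩ :=
    exists_rotation_onto_graph S w hw X hX hX0
  have hs : ∀ l, Summable fun j => ‖M j l‖ := fun l =>
    (hMw l).of_nonneg_of_le (fun _ => norm_nonneg _) fun j =>
      le_mul_of_one_le_right (norm_nonneg _) (hw j)
  have hB : Summable B := hBw.of_nonneg_of_le hB0 fun l => le_mul_of_one_le_right (hB0 l) (hw l)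
  have hEn : ∀ j k, ‖matExp T j k‖ ≤ (if j = k then 1 else 0) + B j * B k := fun j k => by
    have h1 := norm_add_le (matExp T j k - if j = k then 1 else 0) (if j = k then 1 else 0)
    have h2 : ‖(if j = k then 1 else 0 : ℂ)‖ = if j = k then 1 else 0 := by split_ifs <;> simp
    rw [sub_add_cancel, h2] at h1
    linarith [hEB j k]
  have hEs : ∀ k, Summable fun j => ‖matExp T j k‖ := fun k => by
    refine Summable.of_nonneg_of_le (fun _ => norm_nonneg _) (fun j => hEn j k)
      (Summable.add ?_ (hB.mul_right _))
    exact summable_of_ne_finset_zero (s := {k}) fun j hj => by simpa using hj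
  have hE'C : ∀ j l, ‖matExp (fun a b => -T a b) j l‖ ≤ ∑' m, ‖matExp T m j‖ := fun j l => by
    rw [hE', RCLike.norm_conj]
    exact (hEs j).le_tsum l fun _ _ => norm_nonneg _
  let z : S → ℤ → ℂ := fun a l => (if l = (a : ℤ) then 1 else 0) + X a l
  have hz : ∀ a, Summable fun l => ‖z a l‖ := fun a => by
    refine Summable.of_nonneg_of_le (fun _ => norm_nonneg _) (fun l => norm_add_le _ _)
      (Summable.add ?_ ((hX a).of_nonneg_of_le (fun _ => norm_nonneg _) fun l =>
        le_mul_of_one_le_right (norm_nonneg _) (hw l)))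
    exact summable_of_ne_finset_zero (s := {(a : ℤ)}) fun l hl => by simpa using hl
  have hzS : ∀ a b : S, z a b = if b = a then 1 else 0 := fun a b => by
    simp only [z, hX0 a b b.2, add_zero, Subtype.ext_iff]
  have hzn : ∀ (a : S), ∀ l ∉ S, z a l = X a l := fun a l hl => by
    simp only [z, if_neg fun h : l = (a : ℤ) => hl (h ▸ a.2), zero_add]
  have hinv : ∀ a l, (g l : ℂ) * z a l + ∑' m, M l m * z a m =
      ∑ b : S, ((if b = a then (g a : ℂ) else 0) + ∑' m, M b m * z a m) * z b l := by
    intro a l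
    simp only [add_mul, Finset.sum_add_distrib, ite_mul, zero_mul, Finset.sum_ite_eq',
      Finset.mem_univ, if_true]
    by_cases hl : l ∈ S
    · lift l to S using hl
      simp only [hzS, mul_ite, mul_one, mul_zero, Finset.sum_ite_eq, Finset.mem_univ, if_true]
      by_cases h : l = a <;> simp [h]
    · have h1 := hXe a l hl
      simp only [hzn _ l hl]
      linear_combination h1
  have hmain : ∀ j ∉ S, ∀ k ∈ S,
      (∑' l, matExp (fun a b => -T a b) j l * g l * matExp T l k) +
        ∑' l, ∑' m, matExp (fun a b => -T a b) j l * M l m * matExp T m k = 0 :=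
    fun j hj k hk => conjugation_entry_eq_zero hs hK (fun l => (g l : ℂ)) _ _ (hE'C j) z hz _ hinv
      (hann j hj) (fun a => κ a ⟨k, hk⟩) fun l => hκ l ⟨k, hk⟩
  refine ⟨T, B, hT, hTS, hB0, hBw, hTB, fun j k hjk => ?_⟩
  rcases hjk with ⟨hj, hk⟩ | ⟨hk, hj⟩
  · rw [conjugation_entry_conj hM hs hK g hE' j k (hE'C k) (hEs j), hmain k hk j hj, map_zero]
  · exact hmain j hj k hk

lemma one_le_bracket (m : ℤ) : 1 ≤ bracket m :=
  Real.one_le_sqrt.2 (by nlinarith [sq_nonneg (m : ℝ)])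

lemma bracket_neg (m : ℤ) : bracket (-m) = bracket m := by simp [bracket]

lemma bracket_add_le (a b : ℤ) : bracket (a + b) ≤ bracket a * bracket b := by
  rw [bracket, bracket, bracket, ← Real.sqrt_mul (by positivity)]
  refine Real.sqrt_le_sqrt ?_
  push_cast
  nlinarith [sq_nonneg ((a : ℝ) - b), sq_nonneg ((a : ℝ) * b)]

lemma bracket_rpow_add_le {r : ℝ} (hr : 0 ≤ r) (a b : ℤ) :
    bracket (a + b) ^ r ≤ bracket a ^ r * bracket b ^ r := by
  have h : ∀ m, 0 ≤ bracket m := fun m => zero_le_one.trans (one_le_bracket m)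
  rw [← Real.mul_rpow (h a) (h b)]
  exact Real.rpow_le_rpow (h _) (bracket_add_le a b) hr

lemma tanh_strictMono : StrictMono Real.tanh := fun x y hxy => by
  rw [Real.tanh_eq_sinh_div_cosh, Real.tanh_eq_sinh_div_cosh,
    div_lt_div_iff₀ (Real.cosh_pos x) (Real.cosh_pos y)]
  have := Real.sinh_pos_iff.2 (sub_pos.2 hxy)
  rw [Real.sinh_sub] at this
  linarith

lemma quarter_tanh_le_sub {h x y : ℝ} (hh : 0 < h) (hy : 0 ≤ y) (hxy : y + 1 / 4 ≤ x) :
    1 / 4 * Real.tanh (h / 4) ≤ x * Real.tanh (h * x) - y * Real.tanh (h * y) := by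
  have h1 : Real.tanh (h / 4) ≤ Real.tanh (h * x) :=
    tanh_strictMono.monotone (by nlinarith)
  have h2 : Real.tanh (h * y) ≤ Real.tanh (h * x) :=
    tanh_strictMono.monotone (by nlinarith)
  have h3 : 0 ≤ Real.tanh (h / 4) := by
    rw [← Real.tanh_zero]; exact tanh_strictMono.monotone (by linarith)
  nlinarith [mul_le_mul_of_nonneg_left h2 hy,
    mul_nonneg (by linarith : 0 ≤ x - y - 1 / 4) (h3.trans h1)]

lemma dispersion_eq_abs (h θ : ℝ) (k : ℤ) :
    dispersion h θ k = |(k : ℝ) + θ| * Real.tanh (h * |(k : ℝ) + θ|) := by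
  rcases abs_choice ((k : ℝ) + θ) with h1 | h1 <;> rw [h1, dispersion]
  rw [mul_neg, Real.tanh_neg, neg_mul_neg]

lemma dispersion_gap {h θ : ℝ} (hh : 0 < h) (hθ₁ : -(3 / 8) < θ) (hθ₂ : θ < 3 / 8) {a l : ℤ}
    (hal : |a| ≠ |l|) :
    1 / 4 * Real.tanh (h / 4) ≤ |dispersion h θ l - dispersion h θ a| := by
  have hθ : |θ| < 3 / 8 := abs_lt.2 ⟨hθ₁, hθ₂⟩
  have hbd : ∀ k : ℤ, |(k : ℝ) + θ| ≤ |(k : ℝ)| + |θ| ∧ |(k : ℝ)| - |θ| ≤ |(k : ℝ) + θ| := fun k =>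
    ⟨abs_add_le _ _, by simpa using abs_sub_abs_le_abs_sub (k : ℝ) (-θ)⟩
  obtain ⟨ha, ha'⟩ := hbd a
  obtain ⟨hl, hl'⟩ := hbd l
  rw [dispersion_eq_abs, dispersion_eq_abs]
  rcases hal.lt_or_gt with h1 | h1
  · have h2 : |(a : ℝ)| + 1 ≤ |(l : ℝ)| := by exact_mod_cast h1
    exact (quarter_tanh_le_sub hh (abs_nonneg _) (by linarith)).trans (le_abs_self _)
  · have h2 : |(l : ℝ)| + 1 ≤ |(a : ℝ)| := by exact_mod_cast h1
    rw [abs_sub_comm]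
    exact (quarter_tanh_le_sub hh (abs_nonneg _) (by linarith)).trans (le_abs_self _)

lemma nnnorm_mul_ofReal (x : ℂ) (c : ℝ) :
    (‖x‖₊ : ℝ≥0∞) * ENNReal.ofReal c = ENNReal.ofReal (‖x‖ * c) := by
  rw [ENNReal.ofReal_mul (norm_nonneg _), ofReal_norm, enorm_eq_nnnorm]

lemma summable_and_tsum_le_of_ofReal {f : ℤ → ℝ} (hf : ∀ l, 0 ≤ f l) {ρ : ℝ} (hρ : 0 ≤ ρ)
    (h : ∑' l, ENNReal.ofReal (f l) ≤ ENNReal.ofReal ρ) : Summable f ∧ ∑' l, f l ≤ ρ := by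
  have h1 : ∀ s : Finset ℤ, ∑ l ∈ s, f l ≤ ρ := fun s => by
    rw [← ENNReal.ofReal_le_ofReal_iff hρ, ENNReal.ofReal_sum_of_nonneg fun l _ => hf l]
    exact (ENNReal.sum_le_tsum s).trans h
  exact ⟨summable_of_sum_le hf h1, Real.tsum_le_of_sum_le hf h1⟩

/-- Double-eigenspace perturbation: for `h > 0`, `r ≥ 1`, an integer `n ≥ 1` and
`θ ∈ (−3/8, 3/8)`, there is `ρ > 0` such that for every Hermitian matrix `M` with
`‖M‖_r < ρ`, there is an anti-Hermitian matrix `T`, supported where exactly one index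
belongs to `{n, −n}` and with finite `r`-norm, such that the conjugated matrix
`Exp(−T)(G_θ + M)Exp(T)` vanishes at every entry where exactly one index belongs to
`{n, −n}`. -/
theorem double_eigenspace_perturbation
    (h r : ℝ) (hh : 0 < h) (hr : 1 ≤ r) (n : ℤ) (hn : 1 ≤ n)
    (θ : ℝ) (hθ₁ : -(3 / 8) < θ) (hθ₂ : θ < 3 / 8) :
    ∃ ρ : ℝ, 0 < ρ ∧
      ∀ M : ℤ → ℤ → ℂ, (∀ j l : ℤ, M j l = starRingEnd ℂ (M l j)) →
        (⨆ j : ℤ, ∑' l : ℤ, (‖M j l‖₊ : ℝ≥0∞) * ENNReal.ofReal (bracket (j - l) ^ r))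
          < ENNReal.ofReal ρ →
        ∃ T : ℤ → ℤ → ℂ,
          (∀ j k : ℤ, T j k = -starRingEnd ℂ (T k j)) ∧
          (∀ j k : ℤ, ¬(Xor' (j = n ∨ j = -n) (k = n ∨ k = -n)) → T j k = 0) ∧
          (⨆ j : ℤ, ∑' l : ℤ, (‖T j l‖₊ : ℝ≥0∞) * ENNReal.ofReal (bracket (j - l) ^ r))
            < ⊤ ∧
          (∀ j k : ℤ, Xor' (j = n ∨ j = -n) (k = n ∨ k = -n) →
            conjugated h θ M T j k = 0) := by
  have hγ : 0 < 1 / 4 * Real.tanh (h / 4) := by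
    have : Real.tanh 0 < Real.tanh (h / 4) := tanh_strictMono (by linarith)
    rw [Real.tanh_zero] at this
    linarith
  have hr0 : 0 ≤ r := zero_le_one.trans hr
  have hb1 : ∀ l, 1 ≤ bracket l ^ r := fun l => Real.one_le_rpow (one_le_bracket l) hr0
  have hb0 : ∀ l, 0 ≤ bracket l ^ r := fun l => zero_le_one.trans (hb1 l)
  have hS : ∀ j : ℤ, j ∈ ({n, -n} : Finset ℤ) ↔ j = n ∨ j = -n := by simp
  have hSabs : ∀ j : ℤ, j ∈ ({n, -n} : Finset ℤ) ↔ |j| = n := fun j => by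
    rw [hS, abs_eq (by linarith)]
  obtain ⟨ρ, hρ, H⟩ := exists_block_diagonalisation {n, -n} (dispersion h θ) hγ
    (fun a ha l hl => dispersion_gap hh hθ₁ hθ₂ fun hal => by
      rw [hSabs] at ha hl; exact hl (hal ▸ ha)) (fun l => bracket l ^ r) hb1
  refine ⟨ρ, hρ, fun M hM hMρ => ?_⟩
  have hcol : ∀ l, (Summable fun j => ‖M j l‖ * bracket (l - j) ^ r) ∧
      ∑' j, ‖M j l‖ * bracket (l - j) ^ r ≤ ρ := fun l => by
    refine summable_and_tsum_le_of_ofReal (fun j => mul_nonneg (norm_nonneg _) (hb0 _)) hρ.le ?_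
    refine le_trans (le_of_eq (tsum_congr fun j => ?_))
      ((le_iSup _ l).trans hMρ.le)
    rw [nnnorm_mul_ofReal, hM j l, RCLike.norm_conj]
  have hweight : ∀ j l, ‖M j l‖ * bracket j ^ r ≤
      ‖M j l‖ * bracket (l - j) ^ r * bracket l ^ r := fun j l => by
    rw [mul_assoc]
    gcongr
    rw [← neg_sub, bracket_neg]
    simpa using bracket_rpow_add_le hr0 (j - l) l
  have hMw : ∀ l, Summable fun j => ‖M j l‖ * bracket j ^ r := fun l =>
    ((hcol l).1.mul_right _).of_nonneg_of_le (fun j => mul_nonneg (norm_nonneg _) (hb0 _))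
      fun j => hweight j l
  obtain ⟨T, B, hT, hTS, hB0, hBw, hTB, hC⟩ := H M hM hMw
    (fun l => ((hMw l).tsum_le_tsum (fun j => hweight j l) ((hcol l).1.mul_right _)).trans (by
      rw [tsum_mul_right]
      exact mul_le_mul_of_nonneg_right (hcol l).2 (hb0 l)))
    ρ (fun l => by
      have h1 : ∀ j, ‖M j l‖ ≤ ‖M j l‖ * bracket (l - j) ^ r := fun j =>
        le_mul_of_one_le_right (norm_nonneg _) (hb1 _)
      exact (((hcol l).1.of_nonneg_of_le (fun _ => norm_nonneg _) h1).tsum_le_tsum h1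
        (hcol l).1).trans (hcol l).2)
  simp only [hS] at hTS hC
  refine ⟨T, hT, hTS, ?_, hC⟩
  have hBw0 : ∀ l, 0 ≤ B l * bracket l ^ r := fun l => mul_nonneg (hB0 l) (hb0 l)
  set K : ℝ := ∑' l, B l * bracket l ^ r
  refine (iSup_le fun j => ?_).trans_lt (ENNReal.ofReal_lt_top (r := K * K))
  have h1 : ∀ l, ‖T j l‖ * bracket (j - l) ^ r ≤ K * (B l * bracket l ^ r) := fun l => by
    have h2 : bracket (j - l) ^ r ≤ bracket j ^ r * bracket l ^ r := by
      simpa [sub_eq_add_neg, bracket_neg] using bracket_rpow_add_le hr0 j (-l)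
    calc _ ≤ B j * B l * (bracket j ^ r * bracket l ^ r) :=
          mul_le_mul (hTB j l) h2 (hb0 _) (mul_nonneg (hB0 _) (hB0 _))
      _ = B j * bracket j ^ r * (B l * bracket l ^ r) := by ring
      _ ≤ _ := mul_le_mul_of_nonneg_right (hBw.le_tsum j fun i _ => hBw0 i) (hBw0 l)
  calc _ ≤ ∑' l, ENNReal.ofReal (K * (B l * bracket l ^ r)) :=
        ENNReal.tsum_le_tsum fun l => by
          rw [nnnorm_mul_ofReal]; exact ENNReal.ofReal_le_ofReal (h1 l)
    _ = ENNReal.ofReal (K * K) := by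
        rw [← ENNReal.ofReal_tsum_of_nonneg
          (fun l => mul_nonneg (tsum_nonneg hBw0) (hBw0 l)) (hBw.mul_left K), tsum_mul_left]
end
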